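/- arXiv:math/0207057 — 9 statements merged into one kernel-verified Lean document; each statement's English description precedes it below -/
import Mathlib

section
/- Let M be an integral lattice and M' ⊆ M a nondegenerate sublattice. Then the set {a ∈ Aut M' : there exists A ∈ Aut M with A(x) = a(x) for every x ∈ M'} of isometries of M' that extend to isometries of M is a subgroup of finite index in Aut M'. -/
lemma aux_q {M : Type*} [AddCommGroup M] [Module.Free ℤ M] [Module.Finite ℤ M]
    (B : M →ₗ[ℤ] M →ₗ[ℤ] ℤ)
    {N : Type*} [AddCommGroup N] [Module.Free ℤ N] [Module.Finite ℤ N]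
    (ι : N →ₗ[ℤ] M)
    (hnondeg : ∀ x : N, (∀ y : N, B (ι (x)) (ι (y)) = 0) → x = 0) :
    ∃ (d : ℤ) (q : M →ₗ[ℤ] N), d ≠ 0 ∧
      (∀ (x : M) (y : N), B (ι (q x)) (ι (y)) = d * B x (ι y)) ∧ ∀ y : N, q (ι (y)) = d • y := by
  let R : M →ₗ[ℤ] (N →ₗ[ℤ] ℤ) := B.compl₂ ι
  have hR : ∀ x (y : N), R x y = B x (ι y) := fun x y => rfl
  let F : N →ₗ[ℤ] (N →ₗ[ℤ] ℤ) := R.comp ι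
  have hF : ∀ x y : N, F x y = B (ι x) (ι y) := fun x y => rfl
  have hinj : Function.Injective F := by
    rw [← LinearMap.ker_eq_bot, LinearMap.ker_eq_bot']
    intro x hx
    apply hnondeg
    intro y
    rw [← hF, hx]; rfl
  have hrank : Module.finrank ℤ (LinearMap.range F) = Module.finrank ℤ (N →ₗ[ℤ] ℤ) := by
    rw [LinearMap.finrank_range_of_inj hinj]
    rw [Module.finrank_linearMap, Module.finrank_self, mul_one]
  have : Finite ((N →ₗ[ℤ] ℤ) ⧸ LinearMap.range F) :=
    Submodule.finiteQuotientOfFreeOfRankEq _ hrank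
  let d : ℕ := Nat.card ((N →ₗ[ℤ] ℤ) ⧸ LinearMap.range F)
  have hd : d ≠ 0 := Nat.card_pos.ne'
  have hmem : ∀ f : N →ₗ[ℤ] ℤ, (d : ℤ) • f ∈ LinearMap.range F := by
    intro f
    rw [← Submodule.Quotient.mk_eq_zero, Submodule.Quotient.mk_smul, natCast_zsmul]
    exact card_nsmul_eq_zero'
  let e := LinearEquiv.ofInjective F hinj
  let q : M →ₗ[ℤ] N := e.symm.toLinearMap ∘ₗ
    (LinearMap.codRestrict (LinearMap.range F) ((d : ℤ) • R) (fun x => hmem (R x)))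
  have hq : ∀ (x : M) (y : N), B (ι (q x)) (ι (y)) = d * B x (ι y) := by
    intro x y
    have h1 : F (q x) = (d : ℤ) • R x := by
      have : e (q x) = LinearMap.codRestrict (LinearMap.range F) ((d : ℤ) • R)
        (fun x => hmem (R x)) x := e.apply_symm_apply _
      exact congrArg Subtype.val this
    rw [← hF, h1]; rfl
  refine ⟨d, q, by exact_mod_cast hd, hq, ?_⟩
  intro y
  apply sub_eq_zero.1
  apply hnondeg
  intro z
  have := hq (ι y) z
  simp [this]

/-- The key extension step. -/
lemma aux_ext {M : Type*} [AddCommGroup M] [Module.Free ℤ M] [Module.Finite ℤ M]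
    (B : M →ₗ[ℤ] M →ₗ[ℤ] ℤ)
    (hsymm : ∀ x y : M, B x y = B y x)
    {N : Type*} [AddCommGroup N] [Module.Free ℤ N] [Module.Finite ℤ N]
    (ι : N →ₗ[ℤ] M) (d : ℤ) (q : M →ₗ[ℤ] N) (hd : d ≠ 0)
    (hq : ∀ (x : M) (y : N), B (ι (q x)) (ι (y)) = d * B x (ι y))
    (hq' : ∀ y : N, q (ι (y)) = d • y)
    (a : N ≃ₗ[ℤ] N)
    (ha : ∀ x y : N, B (ι (a x)) (ι (a y)) = B (ι (x)) (ι (y)))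
    (had : ∀ x : N, ∃ y : N, a x = x + d • y) :
    ∃ A : M ≃ₗ[ℤ] M, (∀ x y : M, B (A x) (A y) = B x y) ∧
            ∀ x : N, A (ι (x)) = (ι (a x)) := by
  have hcancel : ∀ x y : N, d • x = d • y → x = y := fun x y h => smul_right_injective N hd h
  have key : ∀ c : N →ₗ[ℤ] N, (∀ x : N, ∃ y : N, c x = x + d • y) →
      ∃ b : N →ₗ[ℤ] N, ∀ x, c x = x + d • b x := by
    intro c hc
    choose f hf using hc
    refine ⟨{ toFun := f, map_add' := ?_, map_smul' := ?_ }, hf⟩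
    · intro x y
      apply hcancel
      have h := hf (x + y)
      rw [map_add, hf x, hf y] at h
      rw [smul_add]
      apply add_left_cancel (a := x + y)
      rw [← h]; abel
    · intro n x
      apply hcancel
      have h := hf (n • x)
      rw [map_smul, hf x, smul_add] at h
      have h2 := add_left_cancel h
      rw [← h2, RingHom.id_apply, smul_comm]
  have hai : ∀ x : N, ∃ y : N, a.symm x = x + d • y := by
    intro x
    obtain ⟨y, hy⟩ := had (a.symm x)
    refine ⟨-y, ?_⟩
    rw [a.apply_symm_apply] at hy
    nth_rewrite 2 [hy]
    rw [smul_neg]; abel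
  obtain ⟨b, hb⟩ := key a.toLinearMap had
  obtain ⟨b', hb'⟩ := key a.symm.toLinearMap hai
  simp only [LinearEquiv.coe_coe] at hb hb'
  have h1 : ∀ x, b' x + b x + d • b (b' x) = 0 := by
    intro x
    apply hcancel
    have h := hb (a.symm x)
    rw [a.apply_symm_apply, hb', map_add, map_smul] at h
    have h3 := sub_eq_zero.2 h.symm
    rw [smul_zero, ← h3]
    simp only [smul_add]; abel
  have h2 : ∀ x, b x + b' x + d • b' (b x) = 0 := by
    intro x
    apply hcancel
    have h := hb' (a x)
    rw [a.symm_apply_apply, hb, map_add, map_smul] at h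
    have h3 := sub_eq_zero.2 h.symm
    rw [smul_zero, ← h3]
    simp only [smul_add]; abel
  have inv : ∀ b b' : N →ₗ[ℤ] N, (∀ x, b' x + b x + d • b (b' x) = 0) →
      (LinearMap.id + ι ∘ₗ b ∘ₗ q) ∘ₗ (LinearMap.id + ι ∘ₗ b' ∘ₗ q) =
        LinearMap.id := by
    intro b b' h
    ext x
    have h' := congrArg ι (h (q x))
    simp only [map_add, map_smul, map_zero] at h'
    simp only [LinearMap.comp_apply, LinearMap.add_apply, LinearMap.id_apply,
      map_add, hq', map_smul, map_add, map_smul]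
    refine Eq.trans ?_ ((congrArg (x + ·) h').trans (add_zero x))
    abel
  refine ⟨LinearEquiv.ofLinearMap _ _ (inv b b' h1) (inv b' b h2), ?_, ?_⟩
  · intro x y
    simp only [LinearEquiv.coe_ofLinearMap, LinearMap.comp_apply, LinearMap.add_apply,
      LinearMap.id_apply, map_add]
    have e1 := hq x (b (q y))
    have e2 := hq y (b (q x))
    have e3 := ha (q x) (q y)
    rw [hb, hb] at e3
    simp only [map_add, map_smul, map_add, map_smul, LinearMap.add_apply,
      LinearMap.smul_apply, smul_eq_mul] at e3
    rw [hsymm (ι (b (q x))) (ι (q y))] at e3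
    rw [hsymm (ι (b (q x))) y]
    rw [e1, e2] at e3
    apply mul_left_cancel₀ hd
    apply mul_left_cancel₀ hd
    linear_combination e3
  · intro x
    simp only [LinearEquiv.coe_ofLinearMap, LinearMap.comp_apply, LinearMap.add_apply,
      LinearMap.id_apply, hq', map_smul, hb, map_add]

theorem gen_ext
    {M : Type*} [AddCommGroup M] [Module.Free ℤ M] [Module.Finite ℤ M]
    (B : M →ₗ[ℤ] M →ₗ[ℤ] ℤ)
    (hsymm : ∀ x y : M, B x y = B y x)
    {N : Type*} [AddCommGroup N] [Module.Free ℤ N] [Module.Finite ℤ N]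
    (ι : N →ₗ[ℤ] M)
    (hnondeg : ∀ x : N, (∀ y : N, B (ι (x)) (ι (y)) = 0) → x = 0)
    (AutM' : Subgroup (N ≃ₗ[ℤ] N))
    (hAutM' : ∀ f : N ≃ₗ[ℤ] N,
      f ∈ AutM' ↔ ∀ x y : N, B (ι (f x)) (ι (f y)) = B (ι (x)) (ι (y))) :
    ∃ H : Subgroup (N ≃ₗ[ℤ] N),
      (∀ a : N ≃ₗ[ℤ] N,
        a ∈ H ↔ (∀ x y : N, B (ι (a x)) (ι (a y)) = B (ι (x)) (ι (y))) ∧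
          ∃ A : M ≃ₗ[ℤ] M, (∀ x y : M, B (A x) (A y) = B x y) ∧
            ∀ x : N, A (ι (x)) = (ι (a x))) ∧
      H ≤ AutM' ∧ (H.subgroupOf AutM').FiniteIndex := by
  obtain ⟨d, q, hd, hq, hq'⟩ := aux_q B ι hnondeg
  let H : Subgroup (N ≃ₗ[ℤ] N) :=
    { carrier := {a | (∀ x y : N, B (ι (a x)) (ι (a y)) = B (ι (x)) (ι (y))) ∧
          ∃ A : M ≃ₗ[ℤ] M, (∀ x y : M, B (A x) (A y) = B x y) ∧
            ∀ x : N, A (ι (x)) = (ι (a x))}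
      one_mem' := ⟨fun _ _ => rfl, LinearEquiv.refl ℤ M, fun _ _ => rfl, fun _ => rfl⟩
      mul_mem' := by
        rintro a c ⟨ha, A, hA, hAa⟩ ⟨hc, C, hC, hCc⟩
        refine ⟨fun x y => (ha (c x) (c y)).trans (hc x y), C.trans A,
          fun x y => (hA (C x) (C y)).trans (hC x y), fun x => ?_⟩
        rw [LinearEquiv.trans_apply, hCc, hAa]; rfl
      inv_mem' := by
        rintro a ⟨ha, A, hA, hAa⟩
        refine ⟨fun x y => ?_, A.symm, fun x y => ?_, fun x => ?_⟩
        · have := ha (a.symm x) (a.symm y)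
          rw [a.apply_symm_apply, a.apply_symm_apply] at this
          exact this.symm
        · have := hA (A.symm x) (A.symm y)
          rw [A.apply_symm_apply, A.apply_symm_apply] at this
          exact this.symm
        · rw [LinearEquiv.symm_apply_eq]
          have := hAa (a.symm x)
          rw [a.apply_symm_apply] at this
          exact this.symm }
  refine ⟨H, fun a => Iff.rfl, fun a ha => (hAutM' a).2 ha.1, ?_⟩
  let D : Submodule ℤ N := LinearMap.range (d • (LinearMap.id : N →ₗ[ℤ] N))
  have : Finite (N ⧸ D) := by
    apply Submodule.finiteQuotientOfFreeOfRankEq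
    apply LinearMap.finrank_range_of_inj
    exact fun x y h => smul_right_injective N hd h
  let bs := Module.Free.chooseBasis ℤ N
  let φ : AutM' → (Module.Free.ChooseBasisIndex ℤ N → N ⧸ D) :=
    fun a i => D.mkQ (a.1 (bs i))
  have hφ : ∀ a c : AutM', φ a = φ c → a⁻¹ * c ∈ H.subgroupOf AutM' := by
    intro a c hac
    rw [Subgroup.mem_subgroupOf]
    have hiso := (hAutM' _).1 (a⁻¹ * c).2
    refine ⟨hiso, aux_ext B hsymm ι d q hd hq hq' _ hiso ?_⟩
    have hlin : D.mkQ ∘ₗ a.1.toLinearMap = D.mkQ ∘ₗ c.1.toLinearMap :=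
      bs.ext fun i => congrFun hac i
    intro x
    have h := LinearMap.congr_fun hlin.symm x
    have h' : c.1 x - a.1 x ∈ D := (Submodule.Quotient.eq D).1 h
    obtain ⟨y, hy⟩ := h'
    have hy' : d • y = c.1 x - a.1 x := hy
    refine ⟨a.1.symm y, ?_⟩
    change a.1.symm (c.1 x) = _
    rw [← map_smul, hy', map_sub, a.1.symm_apply_apply]
    abel
  have : Finite (AutM' ⧸ H.subgroupOf AutM') := by
    apply Finite.of_injective (fun z : AutM' ⧸ H.subgroupOf AutM' => φ z.out)
    intro z w h
    rw [← QuotientGroup.out_eq' z, ← QuotientGroup.out_eq' w]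
    exact QuotientGroup.eq.2 (hφ _ _ h)
  exact Subgroup.finiteIndex_of_finite_quotient

/-- For an integral lattice `M` and a nondegenerate sublattice `M' ⊆ M`,
the set of isometries of `M'` that extend to isometries of `M` is a subgroup of finite
index in `Aut M'`. -/
theorem stmt_1
    {M : Type*} [AddCommGroup M] [Module ℤ M] [Module.Free ℤ M] [Module.Finite ℤ M]
    (B : M →ₗ[ℤ] M →ₗ[ℤ] ℤ)
    (hsymm : ∀ x y : M, B x y = B y x)
    (M' : Submodule ℤ M)
    (hnondeg : ∀ x : M', (∀ y : M', B (x : M) (y : M) = 0) → x = 0)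
    (AutM' : Subgroup (M' ≃ₗ[ℤ] M'))
    (hAutM' : ∀ f : M' ≃ₗ[ℤ] M',
      f ∈ AutM' ↔ ∀ x y : M', B (f x : M) (f y : M) = B (x : M) (y : M)) :
    ∃ H : Subgroup (M' ≃ₗ[ℤ] M'),
      (∀ a : M' ≃ₗ[ℤ] M',
        a ∈ H ↔ (∀ x y : M', B (a x : M) (a y : M) = B (x : M) (y : M)) ∧
          ∃ A : M ≃ₗ[ℤ] M, (∀ x y : M, B (A x) (A y) = B x y) ∧
            ∀ x : M', A (x : M) = (a x : M)) ∧
      H ≤ AutM' ∧ (H.subgroupOf AutM').FiniteIndex := by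
  obtain rfl : ‹Module ℤ M› = AddCommGroup.toIntModule M := Subsingleton.elim _ _
  have hmod : M'.module = AddCommGroup.toIntModule M' := Subsingleton.elim _ _
  have hfree : @Module.Free ℤ M' _ _ (AddCommGroup.toIntModule M') :=
    hmod ▸ (inferInstance : @Module.Free ℤ M' _ _ M'.module)
  have hfin : @Module.Finite ℤ M' _ _ (AddCommGroup.toIntModule M') :=
    hmod ▸ (inferInstance : @Module.Finite ℤ M' _ _ M'.module)
  let ι : M' →ₗ[ℤ] M :=
    { toFun := fun x => x
      map_add' := fun _ _ => rfl
      map_smul' := fun n x => by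
        have h : ∀ m : Module ℤ M', m.toSMul.smul n x = M'.module.toSMul.smul n x := by
          intro m
          rw [Subsingleton.elim m M'.module]
        exact congrArg Subtype.val (h (AddCommGroup.toIntModule M')) }
  exact gen_ext B hsymm ι hnondeg AutM' hAutM'
end

section
/- Let M⁺ and M⁻ be nondegenerate integral lattices and let J : M⁻ → M⁺ be a dilation invertible over ℚ, i.e., an injective ℤ-linear map with J(x)·J(y) = k (x·y) for all x, y ∈ M⁻ and some fixed nonzero rational number k, whose ℚ-linear extension J_ℚ : M⁻ ⊗ ℚ → M⁺ ⊗ ℚ is bijective. Then there exists a finite-index subgroup A⁺ ⊆ Aut M⁺ such that for every a ∈ A⁺ the map J_ℚ⁻¹ ∘ (a ⊗ ℚ) ∘ J_ℚ maps M⁻ bijectively onto M⁻ (hence is an isometry b_a of M⁻), and the correspondence a ↦ a ⊕ b_a is a group homomorphism A⁺ → Aut(M⁺ ⊕ M⁻), where M⁺ ⊕ M⁻ carries the orthogonal direct sum form. -/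
open scoped Pointwise in
theorem stab_finiteIndex {P : Type*} [AddCommGroup P] [Module.Finite ℤ P]
    (R : Submodule ℤ P) (h : ∀ p : P, ∃ c : ℤ, c ≠ 0 ∧ c • p ∈ R) :
    ∃ S : Subgroup (P ≃ₗ[ℤ] P), S.FiniteIndex ∧ ∀ a ∈ S, ∀ p, a p ∈ R ↔ p ∈ R := by
  classical
  have tors : Module.IsTorsion ℤ (P ⧸ R) := by
    intro q
    obtain ⟨p, rfl⟩ := Submodule.Quotient.mk_surjective R q
    obtain ⟨c, hc, hp⟩ := h p
    refine ⟨⟨c, mem_nonZeroDivisors_of_ne_zero hc⟩, ?_⟩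
    change c • (Submodule.Quotient.mk p : P ⧸ R) = 0
    rw [← Submodule.Quotient.mk_smul]
    exact (Submodule.Quotient.mk_eq_zero R).2 hp
  have fin1 : Finite (P ⧸ R) := Module.finite_of_fg_torsion _ tors
  obtain ⟨d, hd, hdR⟩ : ∃ d : ℤ, d ≠ 0 ∧ ∀ p : P, d • p ∈ R := by
    refine ⟨(Nat.card (P ⧸ R) : ℤ), by exact_mod_cast Nat.card_pos.ne', fun p => ?_⟩
    rw [← Submodule.Quotient.mk_eq_zero, Submodule.Quotient.mk_smul, Nat.cast_smul_eq_nsmul]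
    exact card_nsmul_eq_zero'
  let D : Submodule ℤ P := LinearMap.range (LinearMap.lsmul ℤ P d)
  have tors2 : Module.IsTorsion ℤ (P ⧸ D) := by
    intro q
    obtain ⟨p, rfl⟩ := Submodule.Quotient.mk_surjective D q
    refine ⟨⟨d, mem_nonZeroDivisors_of_ne_zero hd⟩, ?_⟩
    change d • (Submodule.Quotient.mk p : P ⧸ D) = 0
    rw [← Submodule.Quotient.mk_smul]
    exact (Submodule.Quotient.mk_eq_zero D).2 ⟨p, rfl⟩
  have fin2 : Finite (P ⧸ D) := Module.finite_of_fg_torsion _ tors2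
  refine ⟨MulAction.stabilizer (P ≃ₗ[ℤ] P) (R : Set P), ?_, ?_⟩
  · have horb : (MulAction.orbit (P ≃ₗ[ℤ] P) (R : Set P)).Finite := by
      refine (Set.finite_range
        (fun T : Set (P ⧸ D) => Set.preimage (Submodule.Quotient.mk : P → P ⧸ D) T)).subset ?_
      rintro _ ⟨a, rfl⟩
      refine ⟨Set.image Submodule.Quotient.mk (a • (R : Set P)), ?_⟩
      apply Set.Subset.antisymm _ (Set.subset_preimage_image _ _)
      rintro x ⟨y, ⟨r, hr, rfl⟩, hxy⟩
      obtain ⟨p, hp⟩ := (Submodule.Quotient.eq D).1 hxy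
      change d • p = a r - x at hp
      refine ⟨r - d • a.symm p, R.sub_mem hr (hdR _), ?_⟩
      change a (r - d • a.symm p) = x
      rw [map_sub, map_smul, LinearEquiv.apply_symm_apply, hp]
      abel
    have : Finite (MulAction.orbit (P ≃ₗ[ℤ] P) (R : Set P)) := horb
    have : Finite ((P ≃ₗ[ℤ] P) ⧸ MulAction.stabilizer (P ≃ₗ[ℤ] P) (R : Set P)) :=
      Finite.of_equiv _ (MulAction.orbitEquivQuotientStabilizer (P ≃ₗ[ℤ] P) (R : Set P))
    exact Subgroup.finiteIndex_of_finite_quotient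
  · intro a ha p
    have h1 : a • (R : Set P) = R := ha
    have h2 := Set.smul_mem_smul_set_iff (a := a) (s := (R : Set P)) (x := p)
    rw [h1] at h2
    exact h2

/-- Given nondegenerate integral lattices `M⁺ = P`, `M⁻ = N` and a dilation
`J : N → P` invertible over `ℚ`, there is a finite-index subgroup `A⁺ ⊆ Aut M⁺` such that
for every `a ∈ A⁺` the conjugate `J⁻¹ ∘ a ∘ J` (over `ℚ`) restricts to an isometry `b_a`
of `M⁻`, and `a ↦ a ⊕ b_a` is a group homomorphism `A⁺ → Aut (M⁺ ⊕ M⁻)`.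
(Invertibility of `J` over `ℚ` is expressed by: `J` is injective and every `p ∈ P` has a
nonzero integer multiple lying in the image of `J`.) -/
theorem stmt_3
    {P N : Type*} [AddCommGroup P] [Module ℤ P] [Module.Free ℤ P] [Module.Finite ℤ P]
    [AddCommGroup N] [Module ℤ N] [Module.Free ℤ N] [Module.Finite ℤ N]
    (Bp : P →ₗ[ℤ] P →ₗ[ℤ] ℤ) (Bn : N →ₗ[ℤ] N →ₗ[ℤ] ℤ)
    (hBpsymm : ∀ x y : P, Bp x y = Bp y x)
    (hBnsymm : ∀ x y : N, Bn x y = Bn y x)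
    (hBpnondeg : ∀ x : P, (∀ y : P, Bp x y = 0) → x = 0)
    (hBnnondeg : ∀ x : N, (∀ y : N, Bn x y = 0) → x = 0)
    (J : N →ₗ[ℤ] P)
    (hJinj : Function.Injective J)
    (hJsurjQ : ∀ p : P, ∃ (c : ℤ) (x : N), c ≠ 0 ∧ c • p = J x)
    (k : ℚ) (hk : k ≠ 0)
    (hdil : ∀ x y : N, (Bp (J x) (J y) : ℚ) = k * (Bn x y : ℚ))
    (AutP : Subgroup (P ≃ₗ[ℤ] P))
    (hAutP : ∀ f : P ≃ₗ[ℤ] P, f ∈ AutP ↔ ∀ x y : P, Bp (f x) (f y) = Bp x y) :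
    ∃ (Ap : Subgroup (P ≃ₗ[ℤ] P)) (β : Ap → (N ≃ₗ[ℤ] N)),
      Ap ≤ AutP ∧ (Ap.subgroupOf AutP).FiniteIndex ∧
      -- `β a` is the restriction of `J_ℚ⁻¹ ∘ (a ⊗ ℚ) ∘ J_ℚ` to `M⁻`, a bijection of `M⁻`:
      (∀ (a : Ap) (x : N), J (β a x) = (a : P ≃ₗ[ℤ] P) (J x)) ∧
      -- hence an isometry of `M⁻`:
      (∀ (a : Ap) (x y : N), Bn (β a x) (β a y) = Bn x y) ∧
      -- and `a ↦ a ⊕ β a` is a group homomorphism into `Aut (M⁺ ⊕ M⁻)`: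
      ∃ Φ : Ap →* ((P × N) ≃ₗ[ℤ] (P × N)),
        (∀ (a : Ap) (p : P) (n : N), Φ a (p, n) = ((a : P ≃ₗ[ℤ] P) p, β a n)) ∧
        (∀ (a : Ap) (x y : P × N),
          Bp (Φ a x).1 (Φ a y).1 + Bn (Φ a x).2 (Φ a y).2 = Bp x.1 y.1 + Bn x.2 y.2) := by
  classical
  rename_i iP1 iP2 _ _ iN1 iN2 _ _
  obtain rfl : iP2 = AddCommGroup.toIntModule P := Subsingleton.elim _ _
  obtain rfl : iN2 = AddCommGroup.toIntModule N := Subsingleton.elim _ _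
  obtain ⟨S, hS, hSR⟩ := stab_finiteIndex (LinearMap.range J) (fun p => by
    obtain ⟨c, x, hc, hx⟩ := hJsurjQ p
    exact ⟨c, hc, x, hx.symm⟩)
  have hmap : ∀ a : (AutP ⊓ S : Subgroup (P ≃ₗ[ℤ] P)),
      (LinearMap.range J).map ((a : P ≃ₗ[ℤ] P) : P →ₗ[ℤ] P) = LinearMap.range J := by
    intro a
    ext y
    constructor
    · rintro ⟨r, hr, rfl⟩
      exact (hSR a a.2.2 r).2 hr
    · intro hy
      refine ⟨(a : P ≃ₗ[ℤ] P).symm y, ?_, by simp⟩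
      apply (hSR a a.2.2 _).1
      simpa using hy
  let e := LinearEquiv.ofInjective J hJinj
  let β : (AutP ⊓ S : Subgroup (P ≃ₗ[ℤ] P)) → (N ≃ₗ[ℤ] N) := fun a =>
    (e.trans ((a : P ≃ₗ[ℤ] P).ofSubmodules _ _ (hmap a))).trans e.symm
  have hβ : ∀ a (x : N), J (β a x) = (a : P ≃ₗ[ℤ] P) (J x) := by
    intro a x
    have : e (β a x) = (a : P ≃ₗ[ℤ] P).ofSubmodules _ _ (hmap a) (e x) := by
      simp [β]
    exact congrArg Subtype.val this
  have hiso : ∀ a (x y : N), Bn (β a x) (β a y) = Bn x y := by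
    intro a x y
    have h1 := hdil (β a x) (β a y)
    rw [hβ, hβ, (hAutP a).1 a.2.1, hdil] at h1
    exact_mod_cast (mul_left_cancel₀ hk h1).symm
  refine ⟨AutP ⊓ S, β, inf_le_left, ?_, hβ, hiso, ?_⟩
  · rw [Subgroup.inf_subgroupOf_left]
    infer_instance
  · refine ⟨{ toFun := fun a => (AddEquiv.prodCongr (a : P ≃ₗ[ℤ] P).toAddEquiv (β a).toAddEquiv).toIntLinearEquiv
              map_one' := ?_
              map_mul' := ?_ }, ?_, ?_⟩
    · ext1 ⟨p, n⟩
      refine Prod.ext rfl (hJinj ?_)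
      exact hβ 1 n
    · intro a b
      ext1 ⟨p, n⟩
      refine Prod.ext rfl (hJinj ?_)
      change J (β (a * b) n) = J (β a (β b n))
      rw [hβ, hβ, hβ]
      rfl
    · intro a p n
      rfl
    · intro a x y
      change Bp ((a : P ≃ₗ[ℤ] P) x.1) ((a : P ≃ₗ[ℤ] P) y.1) + Bn (β a x.2) (β a y.2) = _
      rw [hiso, (hAutP a).1 a.2.1]
end

section
/- Let G be a finite group acting by isometries on an integral lattice L such that the real bilinear form on L ⊗ ℝ has positive index of inertia d > 0 (the maximal dimension of a positive definite subspace is d). Let w and w' be two G-invariant d-dimensional ℝ-subspaces of L ⊗ ℝ on which the form is positive definite. Then there exists a G-equivariant ℝ-linear isomorphism f : w → w' preserving the form, i.e., f(x)·f(y) = x·y for all x, y ∈ w and f(g x) = g f(x) for all g ∈ G, x ∈ w. In particular, for every g ∈ G the determinant of the restriction of g to w equals the determinant of the restriction of g to w'. -/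
theorem aux_sqrt {E : Type*} [NormedAddCommGroup E] [InnerProductSpace ℝ E] [FiniteDimensional ℝ E]
    (A : E →ₗ[ℝ] E) (hA : A.IsSymmetric) (hpos : ∀ x, x ≠ 0 → 0 < inner ℝ (A x) x) :
    ∃ S : E →ₗ[ℝ] E, (∀ U : E →ₗ[ℝ] E, Commute A U → Commute S U) ∧
      ∀ x y, inner ℝ (A (S x)) (S y) = inner ℝ x y := by
  classical
  let b := hA.eigenvectorBasis rfl
  let l := hA.eigenvalues rfl
  have hb : ∀ i, A (b i) = l i • b i := fun i => hA.apply_eigenvectorBasis rfl i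
  have hl : ∀ i, 0 < l i := fun i => by
    have h := hpos (b i) (b.orthonormal.ne_zero i)
    rw [hb, inner_smul_left, real_inner_self_eq_norm_sq, b.orthonormal.1 i] at h
    simpa using h
  let s : Finset ℝ := Finset.univ.image l
  let q : Polynomial ℝ := Lagrange.interpolate s id (fun t => (Real.sqrt t)⁻¹)
  have hq : ∀ i, q.eval (l i) = (Real.sqrt (l i))⁻¹ := fun i =>
    Lagrange.eval_interpolate_at_node (s := s) (v := id) (i := l i) (fun t => (Real.sqrt t)⁻¹)
      (Function.injective_id.injOn) (Finset.mem_image_of_mem _ (Finset.mem_univ i))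
  let S : E →ₗ[ℝ] E := Polynomial.aeval A q
  have hS : ∀ i, S (b i) = (Real.sqrt (l i))⁻¹ • b i := fun i => by
    have := Module.End.aeval_apply_of_hasEigenvector (p := q)
      (f := A) (μ := l i) (x := b i)
      ⟨Module.End.mem_eigenspace_iff.2 (hb i), b.orthonormal.ne_zero i⟩
    rw [hq] at this
    exact this
  refine ⟨S, fun U hU => ?_, ?_⟩
  · refine Polynomial.induction_on' (motive := fun q => Commute (Polynomial.aeval A q) U) q ?_ ?_
    · intro p q hp hq
      simpa using hp.add_left hq
    · intro n a
      rw [Polynomial.aeval_monomial]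
      exact Commute.mul_left (Algebra.commutes a U) (hU.pow_left n)
  · let F : E →ₗ[ℝ] E →ₗ[ℝ] ℝ := (innerₗ E).compl₁₂ (A ∘ₗ S) S
    have hF : F = innerₗ E := by
      refine b.toBasis.ext fun i => b.toBasis.ext fun j => ?_
      simp only [F, OrthonormalBasis.coe_toBasis, LinearMap.compl₁₂_apply, LinearMap.comp_apply, hS,
        map_smul, hb, innerₗ_apply_apply, inner_smul_left, inner_smul_right, LinearMap.smul_apply]
      rw [orthonormal_iff_ite.1 b.orthonormal i j]
      split_ifs with h
      · subst h
        have h1 := Real.mul_self_sqrt (hl i).le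
        have h2 := (Real.sqrt_pos.2 (hl i)).ne'
        simp only [smul_eq_mul, conj_trivial]
        field_simp
        nlinarith
      · simp
    intro x y
    exact congrArg (fun H : E →ₗ[ℝ] E →ₗ[ℝ] ℝ => H x y) hF

theorem aux_sqrt' {W : Type*} [AddCommGroup W] [Module ℝ W] [FiniteDimensional ℝ W]
    (B : W →ₗ[ℝ] W →ₗ[ℝ] ℝ) (hsymm : ∀ x y, B x y = B y x) (hB : ∀ x, x ≠ 0 → 0 < B x x)
    (A : W →ₗ[ℝ] W) (hA : ∀ x y, B (A x) y = B x (A y)) (hpos : ∀ x, x ≠ 0 → 0 < B (A x) x) :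
    ∃ S : W →ₗ[ℝ] W, (∀ U : W →ₗ[ℝ] W, Commute A U → Commute S U) ∧
      ∀ x y, B (A (S x)) (S y) = B x y := by
  let c : InnerProductSpace.Core ℝ W :=
    { inner := fun x y => B x y
      conj_inner_symm := fun x y => by simpa using hsymm y x
      re_inner_nonneg := fun x => by
        by_cases h : x = 0
        · simp [h]
        · simpa using (hB x h).le
      add_left := fun x y z => by simp
      smul_left := fun x y r => by simp
      definite := fun x h => by
        by_contra h'
        exact (hB x h').ne' h }
  letI : NormedAddCommGroup W := c.toNormedAddCommGroup
  letI : InnerProductSpace ℝ W := InnerProductSpace.ofCore c.toCore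
  exact aux_sqrt A hA hpos

theorem aux_proj {V : Type*} [AddCommGroup V] [Module ℝ V] [FiniteDimensional ℝ V]
    (B : V →ₗ[ℝ] V →ₗ[ℝ] ℝ) (w : Submodule ℝ V) (hwpos : ∀ x ∈ w, x ≠ 0 → 0 < B x x) :
    ∃ P : V →ₗ[ℝ] w, ∀ x, ∀ y : w, B (P x) y = B x y := by
  let T : w →ₗ[ℝ] Module.Dual ℝ w := B.compl₁₂ w.subtype w.subtype
  have hT : Function.Injective T := by
    rw [← LinearMap.ker_eq_bot, LinearMap.ker_eq_bot']
    intro x hx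
    by_contra h
    have h1 := hwpos x x.2 (by simpa using h)
    have h2 : T x x = 0 := by rw [hx]; rfl
    exact h1.ne' h2
  let e := LinearEquiv.ofInjectiveOfFinrankEq T hT (Subspace.dual_finrank_eq).symm
  refine ⟨e.symm.toLinearMap ∘ₗ (B.compl₁₂ LinearMap.id w.subtype), fun x y => ?_⟩
  have : T (e.symm (B.compl₁₂ LinearMap.id w.subtype x)) = B.compl₁₂ LinearMap.id w.subtype x :=
    e.apply_symm_apply _
  exact congrArg (fun H : w →ₗ[ℝ] ℝ => H y) this

theorem aux_inj {V : Type*} [AddCommGroup V] [Module ℝ V] [FiniteDimensional ℝ V]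
    (B : V →ₗ[ℝ] V →ₗ[ℝ] ℝ) (hsymm : ∀ x y : V, B x y = B y x) (d : ℕ)
    (hdmax : ∀ p : Submodule ℝ V,
      (∀ x ∈ p, x ≠ 0 → 0 < B x x) → Module.finrank ℝ p ≤ d)
    (w : Submodule ℝ V) (hwrank : Module.finrank ℝ w = d)
    (hwpos : ∀ x ∈ w, x ≠ 0 → 0 < B x x)
    (x : V) (hx : x ≠ 0 → 0 < B x x) (h : ∀ y ∈ w, B x y = 0) : x = 0 := by
  by_contra hx0
  have hxp := hx hx0
  have hxw : x ∉ w := fun hm => hxp.ne' (h x hm)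
  have h1 := hdmax (w ⊔ Submodule.span ℝ {x}) (by
    intro z hz hz0
    obtain ⟨y, hy, t, ht, rfl⟩ := Submodule.mem_sup.1 hz
    obtain ⟨a, rfl⟩ := Submodule.mem_span_singleton.1 ht
    have e : B (y + a • x) (y + a • x) = B y y + a * a * B x x := by
      simp only [map_add, map_smul, LinearMap.add_apply, LinearMap.smul_apply, smul_eq_mul,
        hsymm y x, h y hy]
      ring
    rw [e]
    by_cases hy0 : y = 0
    · subst hy0
      have ha : a ≠ 0 := by rintro rfl; simp at hz0
      have := mul_pos (mul_self_pos.2 ha) hxp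
      simpa using this
    · have := hwpos y hy hy0
      have := mul_nonneg (mul_self_nonneg a) hxp.le
      linarith)
  have h2 : w < w ⊔ Submodule.span ℝ {x} := lt_of_le_of_ne le_sup_left fun he => hxw (by
    rw [he]; exact Submodule.mem_sup_right (Submodule.mem_span_singleton_self x))
  have := Submodule.finrank_lt_finrank_of_lt h2
  omega



/-- Let a finite group `G` act by isometries on an integral lattice `L`
(realized as a full lattice `L` inside `V = L ⊗ ℝ`, the action extended to `V`), whose
real form has positive inertia index `d > 0`.  For any two `G`-invariant positive
definite `d`-dimensional subspaces `w, w'` of `V` there is a `G`-equivariant isometric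
isomorphism `w → w'`; in particular the determinants of the restrictions of each `g ∈ G`
to `w` and to `w'` agree. -/
theorem stmt_4
    {V : Type*} [AddCommGroup V] [Module ℝ V] [FiniteDimensional ℝ V]
    (B : V →ₗ[ℝ] V →ₗ[ℝ] ℝ)
    (hsymm : ∀ x y : V, B x y = B y x)
    (L : Submodule ℤ V)
    (hfg : L.FG)
    (hspan : Submodule.span ℝ (L : Set V) = ⊤)
    (hint : ∀ x ∈ L, ∀ y ∈ L, ∃ n : ℤ, B x y = (n : ℝ))
    {G : Type*} [Group G] [Finite G] (ρ : G →* (V ≃ₗ[ℝ] V))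
    (hiso : ∀ (g : G) (x y : V), B (ρ g x) (ρ g y) = B x y)
    (hlat : ∀ g : G, (ρ g) '' (L : Set V) = (L : Set V))
    (d : ℕ) (hd : 0 < d)
    (hdmax : ∀ p : Submodule ℝ V,
      (∀ x ∈ p, x ≠ 0 → 0 < B x x) → Module.finrank ℝ p ≤ d)
    (w w' : Submodule ℝ V)
    (hwrank : Module.finrank ℝ w = d) (hw'rank : Module.finrank ℝ w' = d)
    (hwpos : ∀ x ∈ w, x ≠ 0 → 0 < B x x) (hw'pos : ∀ x ∈ w', x ≠ 0 → 0 < B x x)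
    (hwinv : ∀ g : G, ∀ x ∈ w, (ρ g).toLinearMap x ∈ w)
    (hw'inv : ∀ g : G, ∀ x ∈ w', (ρ g).toLinearMap x ∈ w') :
    (∃ f : w ≃ₗ[ℝ] w',
      (∀ x y : w, B (f x : V) (f y : V) = B (x : V) (y : V)) ∧
      (∀ (g : G) (x : w),
        (f ⟨ρ g (x : V), hwinv g (x : V) x.2⟩ : V) = ρ g (f x : V))) ∧
    ∀ g : G,
      LinearMap.det ((ρ g).toLinearMap.restrict (hwinv g)) =
        LinearMap.det ((ρ g).toLinearMap.restrict (hw'inv g)) := by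
  have main : ∃ f : w ≃ₗ[ℝ] w',
      (∀ x y : w, B (f x : V) (f y : V) = B (x : V) (y : V)) ∧
      (∀ (g : G) (x : w),
        (f ⟨ρ g (x : V), hwinv g (x : V) x.2⟩ : V) = ρ g (f x : V)) := by
    obtain ⟨P, hP⟩ := aux_proj B w hwpos
    obtain ⟨P', hP'⟩ := aux_proj B w' hw'pos
    have uniq : ∀ (u : Submodule ℝ V), (∀ x ∈ u, x ≠ 0 → 0 < B x x) → ∀ a ∈ u, ∀ b ∈ u,
        (∀ y ∈ u, B a y = B b y) → a = b := by
      intro u hu a ha b hb h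
      by_contra hne
      have h1 := hu (a - b) (u.sub_mem ha hb) (sub_ne_zero.2 hne)
      have h2 := h (a - b) (u.sub_mem ha hb)
      rw [map_sub B, LinearMap.sub_apply, h2] at h1
      simp at h1
    have hginv : ∀ (g : G) (x y : V), B (ρ g x) y = B x (ρ g⁻¹ y) := by
      intro g x y
      rw [← hiso g x (ρ g⁻¹ y)]
      have : ρ g (ρ g⁻¹ y) = y := by
        rw [← LinearEquiv.mul_apply, ← map_mul]; simp
      rw [this]
    have equiv : ∀ (u : Submodule ℝ V), (∀ x ∈ u, x ≠ 0 → 0 < B x x) →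
        (∀ g : G, ∀ x ∈ u, (ρ g).toLinearMap x ∈ u) → ∀ Q : V →ₗ[ℝ] u,
        (∀ x, ∀ y : u, B (Q x) y = B x y) → ∀ (g : G) (x : V), (Q (ρ g x) : V) = ρ g (Q x) := by
      intro u hu hui Q hQ g x
      refine uniq u hu _ (Q _).2 _ (hui g _ (Q x).2) fun y hy => ?_
      rw [hQ _ ⟨y, hy⟩, hginv, hginv]
      exact (hQ x ⟨ρ g⁻¹ y, hui g⁻¹ y hy⟩).symm
    have eP := equiv w hwpos hwinv P hP
    have eP' := equiv w' hw'pos hw'inv P' hP'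
    let T : w →ₗ[ℝ] w' := P' ∘ₗ w.subtype
    let A : w →ₗ[ℝ] w := P ∘ₗ w'.subtype ∘ₗ T
    let Bw : w →ₗ[ℝ] w →ₗ[ℝ] ℝ := B.compl₁₂ w.subtype w.subtype
    have hAT : ∀ x y : w, Bw (A x) y = B (T x) (T y) := by
      intro x y
      change B (P (P' x)) y = B (P' x) (P' y)
      rw [hP, hsymm _ (P' (y : V) : V), hP', hsymm]
    have hTinj : ∀ x : w, T x = 0 → x = 0 := by
      intro x hx
      have := aux_inj B hsymm d hdmax w' hw'rank hw'pos x (hwpos x x.2) (fun y hy => by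
        rw [← hP' x ⟨y, hy⟩]
        change B (T x) y = 0
        rw [hx]; simp)
      simpa using this
    obtain ⟨S, hSc, hS⟩ := aux_sqrt' Bw (fun x y => hsymm x y)
      (fun x hx => hwpos x x.2 (by simpa using hx)) A
      (fun x y => by
        change _ = B x (A y)
        rw [hsymm x (A y)]
        change _ = Bw (A y) x
        rw [hAT, hAT, hsymm])
      (fun x hx => by
        rw [hAT]
        exact hw'pos _ (T x).2 (fun h => hx (hTinj x (by simpa using h))))
    let F : w →ₗ[ℝ] w' := T ∘ₗ S
    have hF : ∀ x y : w, B (F x) (F y) = B x y := by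
      intro x y
      have := hS x y
      rw [hAT] at this
      exact this
    have hFinj : Function.Injective F := by
      rw [← LinearMap.ker_eq_bot, LinearMap.ker_eq_bot']
      intro x hx
      by_contra h
      have h1 := hwpos x x.2 (by simpa using h)
      rw [← hF, hx] at h1
      simp at h1
    refine ⟨LinearEquiv.ofInjectiveOfFinrankEq F hFinj (hwrank.trans hw'rank.symm),
      fun x y => hF x y, fun g x => ?_⟩
    change (F ((ρ g).toLinearMap.restrict (hwinv g) x) : V) = ρ g (F x)
    have hc : Commute A ((ρ g).toLinearMap.restrict (hwinv g)) := by
      refine LinearMap.ext fun z => Subtype.ext ?_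
      change (P (P' (ρ g z)) : V) = ρ g (P (P' z))
      rw [eP', eP]
    have h1 : S ((ρ g).toLinearMap.restrict (hwinv g) x) =
        (ρ g).toLinearMap.restrict (hwinv g) (S x) :=
      congrArg (fun H : w →ₗ[ℝ] w => H x) (hSc _ hc).eq
    change (P' (S ((ρ g).toLinearMap.restrict (hwinv g) x)) : V) = ρ g (P' (S x))
    rw [h1]
    exact eP' g (S x)
  refine ⟨main, fun g => ?_⟩
  obtain ⟨f, -, hf⟩ := main
  rw [← LinearMap.det_conj ((ρ g).toLinearMap.restrict (hwinv g)) f]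
  congr 1
  refine LinearMap.ext fun z => Subtype.ext ?_
  have := hf g (f.symm z)
  rw [f.apply_symm_apply] at this
  exact this
end

section
/- Let G be a finite group acting on a finite-dimensional real vector space V by linear automorphisms preserving a symmetric bilinear form b, and let ξ : G → ℂˣ be a group homomorphism that is non-real, i.e., ξ(g) ∉ ℝ for some g ∈ G. Let V_ξ = {ω ∈ V ⊗ ℂ : g ω = ξ(g) ω for all g ∈ G} be the ξ-eigenspace of the complexified action, and similarly V_ξ̄ for the conjugate character ξ̄ : g ↦ conj(ξ(g)). Then: (i) the ℝ-linear map φ_ξ : V_ξ → V, ω ↦ ½(ω + ω̄), is injective (ω̄ denoting the complex conjugate in V ⊗ ℂ); (ii) the image W of φ_ξ equals the image of φ_ξ̄; (iii) the operator J_ξ on W defined by J_ξ(φ_ξ(ω)) = φ_ξ(i ω) satisfies J_ξ² = −id, b(J_ξ x, J_ξ y) = b(x, y) and b(J_ξ x, y) = −b(x, J_ξ y) for all x, y ∈ W (J_ξ is an anti-selfadjoint isometric complex structure); (iv) J_ξ̄ = −J_ξ on W. -/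
open scoped TensorProduct

theorem aux_decomp {V : Type*} [AddCommGroup V] [Module ℝ V] (ω : ℂ ⊗[ℝ] V) :
    ∃ x y : V, ω = (1 : ℂ) ⊗ₜ[ℝ] x + Complex.I ⊗ₜ[ℝ] y := by
  induction ω using TensorProduct.induction_on with
  | zero => exact ⟨0, 0, by simp⟩
  | tmul z v =>
    refine ⟨z.re • v, z.im • v, ?_⟩
    rw [← TensorProduct.smul_tmul, ← TensorProduct.smul_tmul, ← TensorProduct.add_tmul]
    congr 1
    apply Complex.ext <;> simp
  | add a b ha hb =>
    obtain ⟨x, y, rfl⟩ := ha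
    obtain ⟨x', y', rfl⟩ := hb
    refine ⟨x + x', y + y', ?_⟩
    simp only [TensorProduct.tmul_add]
    abel

theorem aux_inj_s5 {V : Type*} [AddCommGroup V] [Module ℝ V] {x y x' y' : V} :
    ((1 : ℂ) ⊗ₜ[ℝ] x + Complex.I ⊗ₜ[ℝ] y = (1 : ℂ) ⊗ₜ[ℝ] x' + Complex.I ⊗ₜ[ℝ] y') ↔
      x = x' ∧ y = y' := by
  constructor
  · intro h
    constructor
    · have := congrArg (fun t => TensorProduct.lid ℝ V (LinearMap.rTensor V Complex.reLm t)) h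
      simpa using this
    · have := congrArg (fun t => TensorProduct.lid ℝ V (LinearMap.rTensor V Complex.imLm t)) h
      simpa using this
  · rintro ⟨rfl, rfl⟩
    rfl

theorem aux_inj' {V : Type*} [AddCommGroup V] [Module ℝ V] {x x' : V} :
    ((1 : ℂ) ⊗ₜ[ℝ] x = (1 : ℂ) ⊗ₜ[ℝ] x') ↔ x = x' := by
  have := @aux_inj_s5 V _ _ x 0 x' 0
  simpa using this

theorem aux_smul {V : Type*} [AddCommGroup V] [Module ℝ V] (z : ℂ) (x y : V) :
    z • ((1 : ℂ) ⊗ₜ[ℝ] x + Complex.I ⊗ₜ[ℝ] y) =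
      (1 : ℂ) ⊗ₜ[ℝ] (z.re • x - z.im • y) + Complex.I ⊗ₜ[ℝ] (z.im • x + z.re • y) := by
  simp only [smul_add, TensorProduct.smul_tmul', TensorProduct.tmul_add, TensorProduct.tmul_sub]
  simp only [← TensorProduct.smul_tmul]
  have h1 : z • (1 : ℂ) = z.re • (1 : ℂ) + z.im • Complex.I := by
    apply Complex.ext <;> simp
  have h2 : z • Complex.I = z.re • Complex.I - z.im • (1 : ℂ) := by
    apply Complex.ext <;> simp
  rw [h1, h2, TensorProduct.add_tmul, TensorProduct.sub_tmul]
  abel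

theorem aux_phi {V : Type*} [AddCommGroup V] [Module ℝ V] (x y : V) :
    (1/2 : ℝ) • (((1 : ℂ) ⊗ₜ[ℝ] x + Complex.I ⊗ₜ[ℝ] y) +
      TensorProduct.map Complex.conjAe.toLinearMap LinearMap.id
        ((1 : ℂ) ⊗ₜ[ℝ] x + Complex.I ⊗ₜ[ℝ] y)) = (1 : ℂ) ⊗ₜ[ℝ] x := by
  have h : TensorProduct.map Complex.conjAe.toLinearMap LinearMap.id
        ((1 : ℂ) ⊗ₜ[ℝ] x + Complex.I ⊗ₜ[ℝ] y) = (1 : ℂ) ⊗ₜ[ℝ] x - Complex.I ⊗ₜ[ℝ] y := by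
    simp [TensorProduct.neg_tmul, sub_eq_add_neg]
  rw [h, add_add_sub_cancel, ← two_smul ℝ, smul_smul]
  norm_num

theorem aux_form (a s P Q R : ℝ) (hs : s ≠ 0) (h1 : a ^ 2 + s ^ 2 = 1)
    (hP : a ^ 2 * P - a * s * R + s ^ 2 * Q = P)
    (hR : 2 * a * s * P - 2 * a * s * Q + (a ^ 2 - s ^ 2) * R = R) : P = Q ∧ R = 0 := by
  have e1 : s * (P - Q) = - a * R := by
    apply mul_left_cancel₀ hs
    linear_combination -hP + P * h1
  have e2 : s * R = a * (P - Q) := by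
    apply mul_left_cancel₀ hs
    linear_combination (-1/2) * hR + R/2 * h1
  have e3 : R = 0 := by linear_combination s * e2 + a * e1 - R * h1
  refine ⟨?_, e3⟩
  rw [e3] at e1
  have : P - Q = 0 := by
    apply mul_left_cancel₀ hs
    linarith
  linarith

/-- Let a finite group `G` act on a finite-dimensional real vector space
`V` preserving a symmetric bilinear form `b`, and let `ξ : G → ℂˣ` be a non-real
character.  On the complexification `ℂ ⊗[ℝ] V` (with conjugation `c` and canonical
inclusion `ι`), consider the eigenspace `S ξ` and the map `φ_ξ : ω ↦ ½(ω + ω̄)`.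
Then: (i) `φ_ξ` is injective (and lands in `V`); (ii) the images `W` of `φ_ξ` and
`φ_ξ̄` coincide; (iii) the operator `J_ξ` on `W` defined by `J_ξ(φ_ξ ω) = φ_ξ(iω)`
satisfies `J_ξ² = −id`, `b(Jx, Jy) = b(x, y)` and `b(Jx, y) = −b(x, Jy)`;
(iv) `J_ξ̄ = −J_ξ` on `W`. -/
theorem stmt_5
    {V : Type*} [AddCommGroup V] [Module ℝ V] [FiniteDimensional ℝ V]
    (b : V →ₗ[ℝ] V →ₗ[ℝ] ℝ)
    (hsymm : ∀ x y : V, b x y = b y x)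
    {G : Type*} [Group G] [Finite G] (ρ : G →* (V ≃ₗ[ℝ] V))
    (hiso : ∀ (g : G) (x y : V), b (ρ g x) (ρ g y) = b x y)
    (ξ : G →* ℂˣ)
    (hnonreal : ∃ g : G, ((ξ g : ℂ)).im ≠ 0)
    -- the canonical inclusion `V → V ⊗ ℂ`
    (ι : V →ₗ[ℝ] ℂ ⊗[ℝ] V) (hι : ι = TensorProduct.mk ℝ ℂ V 1)
    -- complex conjugation on `V ⊗ ℂ`
    (c : ℂ ⊗[ℝ] V →ₗ[ℝ] ℂ ⊗[ℝ] V)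
    (hc : c = TensorProduct.map Complex.conjAe.toLinearMap LinearMap.id)
    -- for a character `χ`, the `χ`-eigenspace of the complexified action
    (S : (G → ℂ) → Set (ℂ ⊗[ℝ] V))
    (hS : ∀ χ : G → ℂ, S χ = {ω : ℂ ⊗[ℝ] V |
      ∀ g : G, LinearMap.baseChange ℂ (ρ g).toLinearMap ω = χ g • ω})
    -- the image `W` of `φ_χ : ω ↦ ½(ω + ω̄)`, viewed inside `V`
    (W : (G → ℂ) → Set V)
    (hW : ∀ χ : G → ℂ, W χ = {x : V | ∃ ω ∈ S χ, ι x = (1/2 : ℝ) • (ω + c ω)})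
    -- `JProp χ J` says: `J : V → V` realizes the operator `φ_χ ∘ (i•) ∘ φ_χ⁻¹` on `W χ`
    (JProp : (G → ℂ) → (V → V) → Prop)
    (hJProp : ∀ (χ : G → ℂ) (J : V → V), JProp χ J ↔
      ∀ ω ∈ S χ, ∀ x : V, ι x = (1/2 : ℝ) • (ω + c ω) →
        ι (J x) = (1/2 : ℝ) • ((Complex.I • ω) + c (Complex.I • ω))) :
    -- (i) `φ_ξ` maps `S ξ` into `V` and is injective:
    (∀ ω ∈ S (fun g => (ξ g : ℂ)), ∃ x : V, ι x = (1/2 : ℝ) • (ω + c ω)) ∧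
    (∀ ω ∈ S (fun g => (ξ g : ℂ)), ∀ ω' ∈ S (fun g => (ξ g : ℂ)),
      (1/2 : ℝ) • (ω + c ω) = (1/2 : ℝ) • (ω' + c ω') → ω = ω') ∧
    -- (ii) the images of `φ_ξ` and `φ_ξ̄` coincide:
    W (fun g => (ξ g : ℂ)) = W (fun g => (starRingEnd ℂ) (ξ g : ℂ)) ∧
    -- (iii) `J_ξ` is an anti-selfadjoint isometric complex structure on `W`:
    (∀ J : V → V, JProp (fun g => (ξ g : ℂ)) J →
      (∀ x ∈ W (fun g => (ξ g : ℂ)), J (J x) = -x) ∧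
      (∀ x ∈ W (fun g => (ξ g : ℂ)), ∀ y ∈ W (fun g => (ξ g : ℂ)),
        b (J x) (J y) = b x y ∧ b (J x) y = - b x (J y))) ∧
    -- (iv) `J_ξ̄ = −J_ξ` on `W`:
    (∀ J J' : V → V, JProp (fun g => (ξ g : ℂ)) J →
      JProp (fun g => (starRingEnd ℂ) (ξ g : ℂ)) J' →
      ∀ x ∈ W (fun g => (ξ g : ℂ)), J' x = - J x) := by
  subst hι hc
  have hmem : ∀ (χ : G → ℂ) (x y : V),
      ((1 : ℂ) ⊗ₜ[ℝ] x + Complex.I ⊗ₜ[ℝ] y) ∈ S χ ↔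
      ∀ g, ρ g x = (χ g).re • x - (χ g).im • y ∧ ρ g y = (χ g).im • x + (χ g).re • y := by
    intro χ x y
    rw [hS]
    simp only [Set.mem_setOf_eq, aux_smul, map_add, LinearMap.baseChange_tmul, aux_inj_s5]
    rfl
  have hWm : ∀ (χ : G → ℂ) (x : V), x ∈ W χ ↔
      ∃ y : V, ((1 : ℂ) ⊗ₜ[ℝ] x + Complex.I ⊗ₜ[ℝ] y) ∈ S χ := by
    intro χ x
    rw [hW]
    constructor
    · rintro ⟨ω, hω, h⟩
      obtain ⟨x', y, rfl⟩ := aux_decomp ω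
      rw [aux_phi, TensorProduct.mk_apply, aux_inj'] at h
      subst h
      exact ⟨y, hω⟩
    · rintro ⟨y, hy⟩
      exact ⟨_, hy, (aux_phi x y).symm⟩
  have hJ : ∀ (χ : G → ℂ) (J : V → V), JProp χ J → ∀ x y : V,
      ((1 : ℂ) ⊗ₜ[ℝ] x + Complex.I ⊗ₜ[ℝ] y) ∈ S χ → J x = -y := by
    intro χ J h x y hxy
    have := (hJProp χ J).1 h _ hxy x (aux_phi x y).symm
    rw [aux_smul, aux_phi, TensorProduct.mk_apply, aux_inj'] at this
    simpa using this
  have hconj : ∀ (χ : G → ℂ) (x y : V), ((1 : ℂ) ⊗ₜ[ℝ] x + Complex.I ⊗ₜ[ℝ] y) ∈ S χ →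
      ((1 : ℂ) ⊗ₜ[ℝ] x + Complex.I ⊗ₜ[ℝ] (-y)) ∈ S (fun g => (starRingEnd ℂ) (χ g)) := by
    intro χ x y h
    rw [hmem] at h ⊢
    intro g
    rw [map_neg, (h g).1, (h g).2]
    simp only [Complex.conj_re, Complex.conj_im]
    constructor <;> module
  have hI : ∀ (χ : G → ℂ) (x y : V), ((1 : ℂ) ⊗ₜ[ℝ] x + Complex.I ⊗ₜ[ℝ] y) ∈ S χ →
      ((1 : ℂ) ⊗ₜ[ℝ] (-y) + Complex.I ⊗ₜ[ℝ] x) ∈ S χ := by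
    intro χ x y h
    rw [hmem] at h ⊢
    intro g
    rw [map_neg, (h g).1, (h g).2]
    constructor <;> module
  obtain ⟨g, hg⟩ := hnonreal
  have hnorm : (ξ g : ℂ).re ^ 2 + (ξ g : ℂ).im ^ 2 = 1 := by
    have h1 : ‖(ξ g : ℂ)‖ = 1 := by
      have hfin : IsOfFinOrder g := isOfFinOrder_of_finite g
      obtain ⟨n, hn, hgn⟩ := isOfFinOrder_iff_pow_eq_one.1 hfin
      apply Complex.norm_eq_one_of_pow_eq_one (n := n) _ hn.ne'
      rw [← Units.val_pow_eq_pow_val, ← map_pow, hgn, map_one, Units.val_one]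
    have h2 := Complex.sq_norm (ξ g : ℂ)
    rw [h1, Complex.normSq_apply] at h2
    linarith
  refine ⟨?_, ?_, ?_, ?_, ?_⟩
  · intro ω _
    obtain ⟨x, y, rfl⟩ := aux_decomp ω
    exact ⟨x, (aux_phi x y).symm⟩
  · intro ω hω ω' hω' h
    obtain ⟨x, y, rfl⟩ := aux_decomp ω
    obtain ⟨x', y', rfl⟩ := aux_decomp ω'
    rw [aux_phi, aux_phi, aux_inj'] at h
    subst h
    have h1 := ((hmem _ _ _).1 hω g).1
    have h2 := ((hmem _ _ _).1 hω' g).1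
    rw [h1] at h2
    have h3 := smul_right_injective V hg (sub_right_injective h2)
    rw [h3]
  · ext x
    rw [hWm, hWm]
    constructor
    · rintro ⟨y, hy⟩
      exact ⟨-y, hconj _ _ _ hy⟩
    · rintro ⟨y, hy⟩
      exact ⟨-y, by simpa using hconj _ _ _ hy⟩
  · intro J hJJ
    constructor
    · intro x hx
      obtain ⟨y, hy⟩ := (hWm _ _).1 hx
      rw [hJ _ J hJJ x y hy, hJ _ J hJJ _ _ (hI _ _ _ hy)]
    · intro x hx x' hx'
      obtain ⟨y, hy⟩ := (hWm _ _).1 hx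
      obtain ⟨y', hy'⟩ := (hWm _ _).1 hx'
      rw [hJ _ J hJJ x y hy, hJ _ J hJJ x' y' hy']
      obtain ⟨e1, e2⟩ := (hmem _ _ _).1 hy g
      obtain ⟨e1', e2'⟩ := (hmem _ _ _).1 hy' g
      have f1 := hiso g x x'
      have f2 := hiso g x y'
      have f3 := hiso g y x'
      rw [e1, e1'] at f1
      rw [e1, e2'] at f2
      rw [e2, e1'] at f3
      simp only [map_add, map_sub, map_smul, LinearMap.add_apply, LinearMap.sub_apply,
        LinearMap.smul_apply, smul_eq_mul] at f1 f2 f3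
      obtain ⟨hPQ, hR⟩ := aux_form (ξ g : ℂ).re (ξ g : ℂ).im (b x x') (b y y')
        (b x y' + b y x') hg hnorm (by linear_combination f1) (by linear_combination f2 + f3)
      simp only [map_neg, LinearMap.neg_apply, neg_neg]
      constructor <;> linarith
  · intro J J' hJJ hJJ' x hx
    obtain ⟨y, hy⟩ := (hWm _ _).1 hx
    rw [hJ _ J hJJ x y hy, hJ _ J' hJJ' x (-y) (hconj _ _ _ hy)]
end

section
/- Let N be a nondegenerate even integral lattice (x² is even for every x ∈ N) and let a finite group G act on N by isometries such that the orthogonal complement (N^G)^⊥ of the fixed sublattice is negative definite. Let v ∈ N be a root whose orthogonal projection v̄ to N^G ⊗ ℝ (well defined since the form is nondegenerate on N^G ⊗ ℝ) satisfies v̄² < 0. Then either (1) (N^G)^⊥ contains a root, or (2) there exists an element w ∈ W_G(N) whose ℝ-linear extension acts on N^G ⊗ ℝ as the reflection against the hyperplane orthogonal to v̄, i.e., w(x) = x − 2((x·v̄)/v̄²) v̄ for all x ∈ N^G ⊗ ℝ. -/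
open Finset in
/-- Product of reflections in pairwise orthogonal roots. -/
lemma exists_prod_refl {V : Type*} [AddCommGroup V] [Module ℝ V]
    (B : V →ₗ[ℝ] V →ₗ[ℝ] ℝ) (N : Submodule ℤ V) (S : Finset V)
    (hS : ∀ r ∈ S, r ∈ N ∧ B r r = -2)
    (hO : ∀ r ∈ S, ∀ s ∈ S, r ≠ s → B r s = 0) :
    ∃ w ∈ Subgroup.closure {f : V ≃ₗ[ℝ] V |
          ∃ r : V, r ∈ N ∧ B r r = -2 ∧ ∀ x : V, f x = x + (B x r) • r},
      ∀ x, w x = x + ∑ r ∈ S, (B x r) • r := by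
  classical
  induction S using Finset.induction_on with
  | empty => exact ⟨1, Subgroup.one_mem _, by simp⟩
  | insert a S ha ih =>
    obtain ⟨w, hw, hwx⟩ := ih (fun r hr => hS r (mem_insert_of_mem hr))
      (fun r hr s hs => hO r (mem_insert_of_mem hr) s (mem_insert_of_mem hs))
    obtain ⟨haN, haa⟩ := hS a (mem_insert_self _ _)
    let f : V →ₗ[ℝ] V := LinearMap.id + (B.flip a).smulRight a
    have hf : ∀ x, f x = x + (B x a) • a := fun x => by simp [f]
    have hinv : Function.Involutive f := by
      intro x
      rw [hf (f x), hf x]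
      simp only [map_add, map_smul, LinearMap.add_apply, LinearMap.smul_apply, haa, smul_eq_mul]
      module
    let e : V ≃ₗ[ℝ] V := LinearEquiv.ofInvolutive f hinv
    have he : ∀ x, e x = x + (B x a) • a := hf
    refine ⟨e * w, Subgroup.mul_mem _ (Subgroup.subset_closure ⟨a, haN, haa, he⟩) hw, ?_⟩
    intro x
    have h0 : B (∑ r ∈ S, (B x r) • r) a = 0 := by
      rw [map_sum, LinearMap.sum_apply]
      refine sum_eq_zero fun r hr => ?_
      rw [map_smul, LinearMap.smul_apply, hO r (mem_insert_of_mem hr) a (mem_insert_self _ _)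
        (by rintro rfl; exact ha hr), smul_zero]
    rw [LinearEquiv.mul_apply, he, hwx, sum_insert ha, map_add, LinearMap.add_apply, h0, add_zero]
    abel

/-- A `G`-invariant finite set of orthogonal roots with common projection `c • vbar`. -/
lemma exists_of_orth {V : Type*} [AddCommGroup V] [Module ℝ V]
    (B : V →ₗ[ℝ] V →ₗ[ℝ] ℝ) (hsymm : ∀ x y : V, B x y = B y x)
    (N : Submodule ℤ V) {G : Type*} [Group G] (ρ : G →* (V ≃ₗ[ℝ] V))
    (hiso : ∀ (g : G) (x y : V), B (ρ g x) (ρ g y) = B x y)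
    (F : Submodule ℝ V) (vbar : V)
    (hvbarsq : B vbar vbar < 0) (hvF : vbar ∈ F) (S : Finset V)
    (hS : ∀ r ∈ S, r ∈ N ∧ B r r = -2)
    (hO : ∀ r ∈ S, ∀ s ∈ S, r ≠ s → B r s = 0)
    (hG : ∀ g, ∀ r ∈ S, ρ g r ∈ S) (hne : S.Nonempty) (c : ℝ)
    (hproj : ∀ r ∈ S, ∀ y ∈ F, B r y = c * B vbar y)
    (hsum : ∑ r ∈ S, r = ((S.card : ℝ) * c) • vbar) :
    ∃ w ∈ Subgroup.closure {f : V ≃ₗ[ℝ] V |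
          ∃ r : V, r ∈ N ∧ B r r = -2 ∧ ∀ x : V, f x = x + (B x r) • r} ⊓
        Subgroup.centralizer (Set.range ρ), ∀ x ∈ F,
      w x = x - (2 * (B x vbar) / (B vbar vbar)) • vbar := by
  classical
  obtain ⟨w, hw, hwx⟩ := exists_prod_refl B N S hS hO
  refine ⟨w, Subgroup.mem_inf.2 ⟨hw, ?_⟩, ?_⟩
  · rw [Subgroup.mem_centralizer_iff]
    rintro _ ⟨g, rfl⟩
    ext x
    rw [LinearEquiv.mul_apply, LinearEquiv.mul_apply, hwx, hwx, map_add, map_sum]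
    congr 1
    refine Finset.sum_bij (fun r _ => ρ g r) (fun r hr => hG g r hr)
      (fun a _ b _ h => (ρ g).injective h) ?_ ?_
    · intro b hb
      refine ⟨ρ g⁻¹ b, hG _ _ hb, ?_⟩
      rw [← LinearEquiv.mul_apply, ← map_mul]; simp
    · intro r _
      rw [hiso, map_smul]
  · intro x hx
    obtain ⟨r, hr⟩ := hne
    have h1 : B (∑ s ∈ S, s) r = -2 := by
      rw [map_sum, LinearMap.sum_apply, Finset.sum_eq_single_of_mem r hr, (hS r hr).2]
      intro s hs hsr
      exact hO s hs r hr hsr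
    rw [hsum, map_smul, LinearMap.smul_apply, hsymm, hproj r hr _ hvF, smul_eq_mul] at h1
    have h2 : ∑ s ∈ S, (B x s) • s = (c * B x vbar) • ∑ s ∈ S, s := by
      rw [Finset.smul_sum]
      refine Finset.sum_congr rfl fun s hs => ?_
      rw [hsymm, hproj s hs x hx, hsymm vbar x]
    rw [hwx, h2, hsum, smul_smul, sub_eq_add_neg, ← neg_smul]
    congr 2
    have : B vbar vbar ≠ 0 := hvbarsq.ne
    field_simp
    linear_combination (B x vbar) * h1


/-- Let `N` be a nondegenerate even integral lattice (realized as a full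
lattice in `V = N ⊗ ℝ`) with a finite group `G` acting by isometries so that `(N^G)^⊥`
is negative definite.  If `v ∈ N` is a root whose orthogonal projection `v̄` to
`N^G ⊗ ℝ` satisfies `v̄² < 0`, then either `(N^G)^⊥` contains a root, or some element of
`W_G(N)` restricts to `N^G ⊗ ℝ` as the reflection in the hyperplane orthogonal to `v̄`. -/
theorem stmt_6
    {V : Type*} [AddCommGroup V] [Module ℝ V] [FiniteDimensional ℝ V]
    (B : V →ₗ[ℝ] V →ₗ[ℝ] ℝ)
    (hsymm : ∀ x y : V, B x y = B y x)
    (hnondeg : ∀ x : V, (∀ y : V, B x y = 0) → x = 0)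
    (N : Submodule ℤ V)
    (hfg : N.FG)
    (hspan : Submodule.span ℝ (N : Set V) = ⊤)
    (hint : ∀ x ∈ N, ∀ y ∈ N, ∃ n : ℤ, B x y = (n : ℝ))
    (heven : ∀ x ∈ N, ∃ m : ℤ, B x x = 2 * (m : ℝ))
    {G : Type*} [Group G] [Finite G] (ρ : G →* (V ≃ₗ[ℝ] V))
    (hiso : ∀ (g : G) (x y : V), B (ρ g x) (ρ g y) = B x y)
    (hlat : ∀ g : G, (ρ g) '' (N : Set V) = (N : Set V))
    -- the fixed lattice `N^G` and its orthogonal complement `(N^G)^⊥` inside `N`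
    (NG : Set V) (hNG : NG = {x : V | x ∈ N ∧ ∀ g : G, ρ g x = x})
    -- `(N^G)^⊥ ⊆ N` is negative definite
    (hneg : ∀ x ∈ N, (∀ y ∈ NG, B x y = 0) → x ≠ 0 → B x x < 0)
    -- the form is nondegenerate on `N^G ⊗ ℝ`
    (hFnondeg : ∀ x ∈ Submodule.span ℝ NG,
      (∀ y ∈ Submodule.span ℝ NG, B x y = 0) → x = 0)
    -- the root `v` and its projection `v̄` to `N^G ⊗ ℝ`
    (v : V) (hv : v ∈ N) (hvroot : B v v = -2)
    (vbar : V) (hvbar₁ : vbar ∈ Submodule.span ℝ NG)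
    (hvbar₂ : ∀ y ∈ Submodule.span ℝ NG, B (v - vbar) y = 0)
    (hvbarsq : B vbar vbar < 0)
    -- the equivariant Weyl group `W_G(N)`
    (WGN : Subgroup (V ≃ₗ[ℝ] V))
    (hWGN : WGN =
      Subgroup.closure {f : V ≃ₗ[ℝ] V |
          ∃ r : V, r ∈ N ∧ B r r = -2 ∧ ∀ x : V, f x = x + (B x r) • r} ⊓
        Subgroup.centralizer (Set.range ρ)) :
    (∃ r : V, r ∈ N ∧ B r r = -2 ∧ ∀ y ∈ NG, B r y = 0) ∨
    (∃ w ∈ WGN, ∀ x ∈ Submodule.span ℝ NG,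
      w x = x - (2 * (B x vbar) / (B vbar vbar)) • vbar) := by
  classical
  by_cases hroot : ∃ r : V, r ∈ N ∧ B r r = -2 ∧ ∀ y ∈ NG, B r y = 0
  · exact Or.inl hroot
  refine Or.inr ?_
  rw [hWGN]
  have hlatm : ∀ g, ∀ x ∈ N, ρ g x ∈ N := by
    intro g x hx
    have : ρ g x ∈ (ρ g) '' (N : Set V) := ⟨x, hx, rfl⟩
    rw [hlat] at this
    exact this
  have hFfix : ∀ g, ∀ y ∈ Submodule.span ℝ NG, ρ g y = y := by
    intro g y hy
    induction hy using Submodule.span_induction with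
    | mem x hx => rw [hNG] at hx; exact hx.2 g
    | zero => simp
    | add x y _ _ h1 h2 => rw [map_add, h1, h2]
    | smul a x _ h => rw [map_smul, h]
  -- sums over invariant sets
  have hsumS : ∀ (S : Finset V) (c : ℝ), (∀ r ∈ S, r ∈ N) → (∀ g, ∀ r ∈ S, ρ g r ∈ S) →
      (∀ r ∈ S, ∀ y ∈ Submodule.span ℝ NG, B r y = c * B vbar y) →
      ∑ r ∈ S, r = ((S.card : ℝ) * c) • vbar := by
    intro S c hSN hSG hproj
    have hmem : ∑ r ∈ S, r ∈ Submodule.span ℝ NG := by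
      apply Submodule.subset_span
      rw [hNG]
      refine ⟨N.sum_mem hSN, fun g => ?_⟩
      rw [map_sum]
      refine Finset.sum_bij (fun r _ => ρ g r) (fun r hr => hSG g r hr)
        (fun a _ b _ h => (ρ g).injective h) ?_ (fun _ _ => rfl)
      intro b hb
      refine ⟨ρ g⁻¹ b, hSG _ _ hb, ?_⟩
      rw [← LinearEquiv.mul_apply, ← map_mul]; simp
    rw [← sub_eq_zero]
    refine hFnondeg _ (Submodule.sub_mem _ hmem (Submodule.smul_mem _ _ hvbar₁)) ?_
    intro y hy
    rw [map_sub, LinearMap.sub_apply, map_sum, LinearMap.sum_apply,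
      Finset.sum_congr rfl (fun r hr => hproj r hr y hy), map_smul, LinearMap.smul_apply]
    simp
    ring
  -- the orbit
  let O : Finset V := (Set.finite_range (fun g => ρ g v)).toFinset
  have hOmem : ∀ a, a ∈ O ↔ ∃ g, ρ g v = a := by intro a; simp [O]
  have hON : ∀ a ∈ O, a ∈ N := by
    intro a ha; obtain ⟨g, rfl⟩ := (hOmem a).1 ha; exact hlatm g v hv
  have hOr : ∀ a ∈ O, B a a = -2 := by
    intro a ha; obtain ⟨g, rfl⟩ := (hOmem a).1 ha; rw [hiso, hvroot]
  have hOG : ∀ g, ∀ a ∈ O, ρ g a ∈ O := by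
    intro g a ha
    obtain ⟨h, rfl⟩ := (hOmem a).1 ha
    exact (hOmem _).2 ⟨g * h, by rw [map_mul, LinearEquiv.mul_apply]⟩
  have hOp : ∀ a ∈ O, ∀ y ∈ Submodule.span ℝ NG, B a y = B vbar y := by
    intro a ha y hy
    obtain ⟨g, rfl⟩ := (hOmem a).1 ha
    have h1 := hiso g v y
    rw [hFfix g y hy] at h1
    have h2 := hvbar₂ y hy
    rw [map_sub, LinearMap.sub_apply] at h2
    linarith
  have hOv : v ∈ O := (hOmem v).2 ⟨1, by simp⟩
  have hOne : O.Nonempty := ⟨v, hOv⟩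
  have hOsum := hsumS O 1 hON hOG (fun r hr y hy => by rw [one_mul]; exact hOp r hr y hy)
  have hOneg : ∀ a ∈ O, ∑ b ∈ O, B b a < 0 := by
    intro a ha
    have : ∑ b ∈ O, B b a = B (∑ b ∈ O, b) a := by rw [map_sum, LinearMap.sum_apply]
    rw [this, hOsum, map_smul, LinearMap.smul_apply, hsymm, hOp a ha _ hvbar₁, smul_eq_mul,
      mul_one]
    have : (0 : ℝ) < O.card := by exact_mod_cast hOne.card_pos
    nlinarith
  have hnn : ∀ a ∈ O, ∀ b ∈ O, a ≠ b → ∃ n : ℤ, B a b = n ∧ 0 ≤ n := by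
    intro a ha b hb hab
    obtain ⟨n, hn⟩ := hint a (hON a ha) b (hON b hb)
    refine ⟨n, hn, ?_⟩
    have hd : ∀ y ∈ NG, B (a - b) y = 0 := by
      intro y hy
      have hy' := Submodule.subset_span (R := ℝ) hy
      rw [map_sub, LinearMap.sub_apply, hOp a ha y hy', hOp b hb y hy', sub_self]
    have hdN : a - b ∈ N := N.sub_mem (hON a ha) (hON b hb)
    have hsq : B (a - b) (a - b) = -4 - 2 * n := by
      simp only [map_sub, LinearMap.sub_apply, hOr a ha, hOr b hb, hsymm b a, hn]
      ring
    have hlt := hneg _ hdN hd (sub_ne_zero.2 hab)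
    rw [hsq] at hlt
    have h1 : -2 < n := by
      have : (-2 : ℝ) < n := by linarith
      exact_mod_cast this
    have h2 : n ≠ -1 := by
      rintro rfl
      exact hroot ⟨a - b, hdN, by rw [hsq]; norm_num, hd⟩
    omega
  have hnnR : ∀ a ∈ O, ∀ b ∈ O, a ≠ b → 0 ≤ B a b := by
    intro a ha b hb hab
    obtain ⟨n, h, h'⟩ := hnn a ha b hb hab
    rw [h]; exact_mod_cast h'
  have hlt2 : ∀ a ∈ O, ∑ b ∈ O.erase a, B b a < 2 := by
    intro a ha
    have h1 := hOneg a ha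
    rw [← Finset.add_sum_erase O _ ha, hOr a ha] at h1
    linarith
  have henn : ∀ a ∈ O, ∀ b ∈ O.erase a, 0 ≤ B b a := fun a ha b hb =>
    hnnR b (Finset.mem_of_mem_erase hb) a ha (Finset.ne_of_mem_erase hb)
  have h01 : ∀ a ∈ O, ∀ b ∈ O, a ≠ b → B a b ≠ 1 → B a b = 0 := by
    intro a ha b hb hab h1
    have hle := Finset.single_le_sum (henn b hb) (Finset.mem_erase.2 ⟨hab, ha⟩)
    have hl := hlt2 b hb
    obtain ⟨n, h, h'⟩ := hnn a ha b hb hab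
    rw [h] at hle h1 ⊢
    have hn2 : n < 2 := by
      have : (n : ℝ) < 2 := by linarith
      exact_mod_cast this
    have : n ≠ 1 := by rintro rfl; simp at h1
    have : n = 0 := by omega
    simp [this]
  have huniq : ∀ a ∈ O, ∀ b ∈ O, ∀ b' ∈ O, B b a = 1 → B b' a = 1 → b = b' := by
    intro a ha b hb b' hb' h h'
    by_contra hne
    have e1 : b ≠ a := by rintro rfl; rw [hOr b hb] at h; norm_num at h
    have e2 : b' ≠ a := by rintro rfl; rw [hOr b' hb'] at h'; norm_num at h'
    have hsub : ({b, b'} : Finset V) ⊆ O.erase a := by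
      intro x hx
      simp only [Finset.mem_insert, Finset.mem_singleton] at hx
      rcases hx with rfl | rfl
      · exact Finset.mem_erase.2 ⟨e1, hb⟩
      · exact Finset.mem_erase.2 ⟨e2, hb'⟩
    have hle := Finset.sum_le_sum_of_subset_of_nonneg hsub
      (fun i hi _ => henn a ha i hi)
    rw [Finset.sum_pair hne, h, h'] at hle
    linarith [hlt2 a ha]
  by_cases hc : ∃ a ∈ O, ∃ b ∈ O, B a b = 1
  · let S : Finset V := ((O ×ˢ O).filter (fun p => B p.1 p.2 = 1)).image (fun p => p.1 + p.2)
    have hSmem : ∀ r, r ∈ S ↔ ∃ a ∈ O, ∃ b ∈ O, B a b = 1 ∧ a + b = r := by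
      intro r
      simp only [S, Finset.mem_image, Finset.mem_filter, Finset.mem_product, Prod.exists]
      constructor
      · rintro ⟨a, b, ⟨⟨h1, h2⟩, h3⟩, h4⟩; exact ⟨a, h1, b, h2, h3, h4⟩
      · rintro ⟨a, h1, b, h2, h3, h4⟩; exact ⟨a, b, ⟨⟨h1, h2⟩, h3⟩, h4⟩
    have hSN : ∀ r ∈ S, r ∈ N ∧ B r r = -2 := by
      intro r hr
      obtain ⟨a, ha, b, hb, h, rfl⟩ := (hSmem r).1 hr
      refine ⟨N.add_mem (hON a ha) (hON b hb), ?_⟩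
      simp only [map_add, LinearMap.add_apply, hOr a ha, hOr b hb, hsymm b a, h]
      norm_num
    have hSG : ∀ g, ∀ r ∈ S, ρ g r ∈ S := by
      intro g r hr
      obtain ⟨a, ha, b, hb, h, rfl⟩ := (hSmem r).1 hr
      exact (hSmem _).2 ⟨ρ g a, hOG g a ha, ρ g b, hOG g b hb, by rw [hiso, h], by rw [map_add]⟩
    have hSp : ∀ r ∈ S, ∀ y ∈ Submodule.span ℝ NG, B r y = 2 * B vbar y := by
      intro r hr y hy
      obtain ⟨a, ha, b, hb, h, rfl⟩ := (hSmem r).1 hr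
      rw [map_add, LinearMap.add_apply, hOp a ha y hy, hOp b hb y hy]; ring
    have hSO : ∀ r ∈ S, ∀ s ∈ S, r ≠ s → B r s = 0 := by
      intro r hr s hs hrs
      obtain ⟨a, ha, b, hb, h, rfl⟩ := (hSmem r).1 hr
      obtain ⟨a', ha', b', hb', h', rfl⟩ := (hSmem s).1 hs
      have hba : B b a = 1 := by rw [hsymm, h]
      have hba' : B b' a' = 1 := by rw [hsymm, h']
      have n1 : a ≠ a' := by
        rintro rfl
        exact hrs (by rw [huniq a ha b hb b' hb' hba hba'])
      have n2 : a ≠ b' := by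
        rintro rfl
        exact hrs (by rw [huniq a ha b hb a' ha' hba h', add_comm])
      have n3 : b ≠ a' := by
        rintro rfl
        exact hrs (by rw [huniq b hb a ha b' hb' h hba', add_comm])
      have n4 : b ≠ b' := by
        rintro rfl
        exact hrs (by rw [huniq b hb a ha a' ha' h h'])
      have z1 := h01 a ha a' ha' n1
        (fun e => n3 (huniq a ha b hb a' ha' hba (by rw [hsymm, e])))
      have z2 := h01 a ha b' hb' n2
        (fun e => n4 (huniq a ha b hb b' hb' hba (by rw [hsymm, e])))
      have z3 := h01 b hb a' ha' n3
        (fun e => n1 (huniq b hb a ha a' ha' h (by rw [hsymm, e])))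
      have z4 := h01 b hb b' hb' n4
        (fun e => n2 (huniq b hb a ha b' hb' h (by rw [hsymm, e])))
      simp only [map_add, LinearMap.add_apply, z1, z2, z3, z4, add_zero]
    have hSne : S.Nonempty := by
      obtain ⟨a, ha, b, hb, h⟩ := hc
      exact ⟨a + b, (hSmem _).2 ⟨a, ha, b, hb, h, rfl⟩⟩
    exact exists_of_orth B hsymm N ρ hiso _ vbar hvbarsq hvbar₁ S hSN hSO hSG hSne 2 hSp
      (hsumS S 2 (fun r hr => (hSN r hr).1) hSG hSp)
  · push Not at hc
    exact exists_of_orth B hsymm N ρ hiso _ vbar hvbarsq hvbar₁ O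
      (fun r hr => ⟨hON r hr, hOr r hr⟩)
      (fun r hr s hs hrs => h01 r hr s hs hrs (hc r hr s hs)) hOG hOne 1
      (fun r hr y hy => by rw [one_mul]; exact hOp r hr y hy) hOsum
end

section
/- Let R be a nonzero negative definite integral lattice generated as a ℤ-module by its roots, and assume R is irreducible: whenever R is the orthogonal direct sum of two sublattices R₁ and R₂ (R = R₁ + R₂, R₁·R₂ = 0, R₁ ∩ R₂ = 0), one of R₁, R₂ is zero. Let a finite group G act faithfully on R by isometries such that the action is admissible ((R^G)^⊥ contains no root of R) and b-transitive (R is generated as a ℤ-module by the orbit {g v₀ : g ∈ G} of some root v₀). Then either (a) R has rank 1 and G is trivial, or (b) R has rank 2 with a basis consisting of two roots u, v satisfying u·v = 1 (so R is isometric to the root lattice A₂ with Gram matrix [[−2, 1], [1, −2]]), G has order 2, and the nontrivial element of G interchanges u and v. -/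
/-- A faithful admissible b-transitive action of a finite group `G` on a
nonzero irreducible elliptic (negative definite) root system `R` (realized as a full
lattice in `V = R ⊗ ℝ`) is either the trivial action on a rank-1 root lattice `A₁`, or
the order-2 action on `A₂` interchanging two roots `u`, `v` with `u·v = 1`. -/
theorem stmt_8
    {V : Type*} [AddCommGroup V] [Module ℝ V] [FiniteDimensional ℝ V]
    (B : V →ₗ[ℝ] V →ₗ[ℝ] ℝ)
    (hsymm : ∀ x y : V, B x y = B y x)
    (hnegdef : ∀ x : V, x ≠ 0 → B x x < 0)
    (R : Submodule ℤ V)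
    (hfg : R.FG)
    (hspan : Submodule.span ℝ (R : Set V) = ⊤)
    (hint : ∀ x ∈ R, ∀ y ∈ R, ∃ n : ℤ, B x y = (n : ℝ))
    (hR0 : R ≠ ⊥)
    -- `R` is a root system: it is generated by its roots
    (hgen : Submodule.span ℤ {r : V | r ∈ R ∧ B r r = -2} = R)
    -- `R` is irreducible
    (hirr : ∀ R₁ R₂ : Submodule ℤ V, R₁ ⊔ R₂ = R →
      (∀ x ∈ R₁, ∀ y ∈ R₂, B x y = 0) → R₁ ⊓ R₂ = ⊥ → R₁ = ⊥ ∨ R₂ = ⊥)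
    {G : Type*} [Group G] [Finite G] (ρ : G →* (V ≃ₗ[ℝ] V))
    (hiso : ∀ (g : G) (x y : V), B (ρ g x) (ρ g y) = B x y)
    (hlat : ∀ g : G, (ρ g) '' (R : Set V) = (R : Set V))
    -- faithfulness
    (hfaith : ∀ g : G, (∀ x ∈ R, ρ g x = x) → g = 1)
    -- admissibility: `(R^G)^⊥` contains no root
    (hadm : ¬ ∃ r : V, r ∈ R ∧ B r r = -2 ∧
      ∀ y ∈ R, (∀ g : G, ρ g y = y) → B r y = 0)
    -- b-transitivity: the orbit of some root generates `R`
    (htrans : ∃ v₀ : V, v₀ ∈ R ∧ B v₀ v₀ = -2 ∧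
      Submodule.span ℤ {x : V | ∃ g : G, x = ρ g v₀} = R) :
    (Module.finrank ℝ V = 1 ∧ ∀ g : G, g = 1) ∨
    (Module.finrank ℝ V = 2 ∧
      ∃ u v : V, u ∈ R ∧ v ∈ R ∧
        B u u = -2 ∧ B v v = -2 ∧ B u v = 1 ∧
        Submodule.span ℤ ({u, v} : Set V) = R ∧
        Nat.card G = 2 ∧
        ∃ σ : G, σ ≠ 1 ∧ ρ σ u = v ∧ ρ σ v = u) := by
  classical
  obtain ⟨v₀, hv₀R, hv₀, hO⟩ := htrans
  have hBpos : ∀ x : V, B x x = 0 → x = 0 := by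
    intro x hx
    by_contra h
    exact absurd hx (hnegdef x h).ne
  set O : Set V := {x : V | ∃ g : G, x = ρ g v₀} with hOdef
  have hv₀O : v₀ ∈ O := ⟨1, by simp⟩
  have hOR : ∀ e ∈ O, e ∈ R := fun e he => hO ▸ Submodule.subset_span he
  have hgO : ∀ (g : G), ∀ e ∈ O, ρ g e ∈ O := by
    rintro g e ⟨h, rfl⟩
    exact ⟨g * h, by simp⟩
  have hinv : ∀ (g : G) (x : V), ρ g⁻¹ (ρ g x) = x := by
    intro g x
    have : (ρ g⁻¹ * ρ g) x = x := by rw [← map_mul]; simp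
    exact this
  have hinv2 : ∀ (g : G) (x : V), ρ g (ρ g⁻¹ x) = x := by
    intro g x
    have := hinv g⁻¹ x
    rwa [inv_inv] at this
  have hOroot : ∀ e ∈ O, B e e = -2 := by
    rintro e ⟨g, rfl⟩
    rw [hiso, hv₀]
  have hOfix : ∀ e ∈ O, ∀ y : V, (∀ g : G, ρ g y = y) → B e y = B v₀ y := by
    rintro e ⟨g, rfl⟩ y hy
    rw [← hiso g v₀ y, hy]
  -- an invariant vector pairing nontrivially with the orbit
  obtain ⟨y, hyfix, hyne⟩ : ∃ y : V, (∀ g : G, ρ g y = y) ∧ B v₀ y ≠ 0 := by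
    by_contra hcon
    push Not at hcon
    exact hadm ⟨v₀, hv₀R, hv₀, fun y _ hy => hcon y hy⟩
  have hpair : ∀ e ∈ O, ∀ f ∈ O, e ≠ f → B e f = 0 ∨ B e f = 1 := by
    intro e he f hf hef
    obtain ⟨n, hn⟩ := hint e (hOR e he) f (hOR f hf)
    have h1 : B (e - f) (e - f) = -4 - 2 * n := by
      simp only [map_sub, LinearMap.sub_apply, hOroot e he, hOroot f hf, hsymm f e, hn]
      ring
    have h2 : B (e + f) (e + f) = -4 + 2 * n := by
      simp only [map_add, LinearMap.add_apply, hOroot e he, hOroot f hf, hsymm f e, hn]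
      ring
    have h3 := hnegdef (e - f) (sub_ne_zero.2 hef)
    have hne : e + f ≠ 0 := by
      intro h0
      have h4 : B (e + f) y = 0 := by rw [h0]; simp
      rw [map_add, LinearMap.add_apply, hOfix e he y hyfix, hOfix f hf y hyfix] at h4
      exact hyne (by linarith)
    have h4 := hnegdef (e + f) hne
    have h5 : n ≠ -1 := by
      rintro rfl
      refine hadm ⟨e - f, R.sub_mem (hOR e he) (hOR f hf), ?_, ?_⟩
      · rw [h1]; norm_num
      · intro z _ hz
        rw [map_sub, LinearMap.sub_apply, hOfix e he z hz, hOfix f hf z hz, sub_self]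
    rw [h1] at h3
    rw [h2] at h4
    have h6 : -2 < n := by
      have : (-2 : ℝ) < n := by linarith
      exact_mod_cast this
    have h7 : n < 2 := by
      have : (n : ℝ) < 2 := by linarith
      exact_mod_cast this
    have h8 : n = 0 ∨ n = 1 := by omega
    rcases h8 with rfl | rfl
    · left; simpa using hn
    · right; simpa using hn
  -- the orbit sum
  have hfin : O.Finite := by
    have : O = Set.range (fun g : G => ρ g v₀) := by
      ext x; simp [hOdef, eq_comm]
    rw [this]; exact Set.finite_range _
  let F : Finset V := hfin.toFinset
  have hF : ∀ x, x ∈ F ↔ x ∈ O := fun x => hfin.mem_toFinset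
  have hsfix : ∀ g : G, ρ g (∑ x ∈ F, x) = ∑ x ∈ F, x := by
    intro g
    rw [map_sum]
    refine Finset.sum_bij' (fun x _ => ρ g x) (fun x _ => ρ g⁻¹ x) ?_ ?_ ?_ ?_ ?_
    · intro a ha; rw [hF] at ha ⊢; exact hgO g a ha
    · intro a ha; rw [hF] at ha ⊢; exact hgO g⁻¹ a ha
    · intro a _; exact hinv g a
    · intro a _; exact hinv2 g a
    · intro a _; rfl
  have hcard : (0 : ℝ) < F.card := by
    exact_mod_cast Finset.card_pos.2 ⟨v₀, (hF _).2 hv₀O⟩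
  have hsum : ∀ z : V, (∀ g : G, ρ g z = z) → B (∑ x ∈ F, x) z = F.card * B v₀ z := by
    intro z hz
    rw [map_sum, LinearMap.sum_apply, Finset.sum_congr rfl
      (fun x hx => hOfix x ((hF x).1 hx) z hz)]
    simp
  have hsne : (∑ x ∈ F, x) ≠ 0 := by
    intro h0
    have h1 := hsum y hyfix
    rw [h0] at h1
    simp only [map_zero, LinearMap.zero_apply] at h1
    rcases mul_eq_zero.1 h1.symm with h | h
    · exact hcard.ne' h
    · exact hyne h
  have hneg : ∀ e ∈ O, ∑ x ∈ F, B e x < 0 := by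
    intro e he
    have h1 := hnegdef _ hsne
    rw [hsum _ hsfix] at h1
    have h2 : B v₀ (∑ x ∈ F, x) < 0 := by
      by_contra h
      push Not at h
      have := mul_nonneg hcard.le h
      linarith
    rw [← hOfix e he _ hsfix, map_sum] at h2
    exact h2
  have huniq : ∀ e ∈ O, ∀ a ∈ O, ∀ b ∈ O, e ≠ a → e ≠ b → a ≠ b → B e a = 1 → B e b = 1 → False := by
    intro e he a ha b hb hea heb hab h1 h2
    have hsub : ({e, a, b} : Finset V) ⊆ F := by
      intro x hx
      simp only [Finset.mem_insert, Finset.mem_singleton] at hx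
      rw [hF]
      rcases hx with rfl | rfl | rfl <;> assumption
    have h3 : ∑ x ∈ ({e, a, b} : Finset V), B e x ≤ ∑ x ∈ F, B e x := by
      refine Finset.sum_le_sum_of_subset_of_nonneg hsub ?_
      intro x hx hx2
      have hxe : e ≠ x := by
        rintro rfl
        exact hx2 (by simp)
      rcases hpair e he x ((hF x).1 hx) hxe with h | h <;> rw [h]
      norm_num
    have h4 := hneg e he
    rw [Finset.sum_insert (by simp [hea, heb]), Finset.sum_insert (by simp [hab]),
      Finset.sum_singleton, h1, h2, hOroot e he] at h3
    linarith
  have hOne : ∀ e ∈ O, e ≠ 0 := by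
    intro e he h0
    have := hOroot e he
    rw [h0] at this
    simp at this
  -- splitting off an orthogonal part
  have hsplit : ∀ S : Set V, S ⊆ O → v₀ ∈ S → (∀ a ∈ S, ∀ b ∈ O, b ∉ S → B a b = 0) → O ⊆ S := by
    intro S hSO hvS hperp
    have horth : ∀ x ∈ Submodule.span ℤ S, ∀ z ∈ Submodule.span ℤ (O \ S), B x z = 0 := by
      intro x hx z hz
      induction hx using Submodule.span_induction with
      | mem a ha =>
        induction hz using Submodule.span_induction with
        | mem b hb => exact hperp a ha b hb.1 hb.2
        | zero => simp
        | add p q _ _ hp hq => rw [map_add, hp, hq, add_zero]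
        | smul n p _ hp => rw [map_zsmul, hp, smul_zero]
      | zero => simp
      | add p q _ _ hp hq => rw [map_add, LinearMap.add_apply, hp, hq, add_zero]
      | smul n p _ hp => rw [map_zsmul, LinearMap.smul_apply, hp, smul_zero]
    have := hirr (Submodule.span ℤ S) (Submodule.span ℤ (O \ S)) (by
      rw [← Submodule.span_union, Set.union_sdiff_cancel hSO, hO]) horth (by
      rw [eq_bot_iff]
      intro x hx
      exact (Submodule.mem_bot ℤ).2 (hBpos x (horth x hx.1 x hx.2)))
    rcases this with h | h
    · exfalso
      have h1 : v₀ ∈ Submodule.span ℤ S := Submodule.subset_span hvS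
      rw [h, Submodule.mem_bot] at h1
      exact hOne v₀ hv₀O h1
    · intro x hx
      by_contra hxS
      have h1 : x ∈ Submodule.span ℤ (O \ S) := Submodule.subset_span ⟨hx, hxS⟩
      rw [h, Submodule.mem_bot] at h1
      exact hOne x hx h1
  have hfaithO : ∀ g : G, (∀ x ∈ O, ρ g x = x) → g = 1 := by
    intro g hg
    apply hfaith
    intro x hx
    rw [← hO] at hx
    induction hx using Submodule.span_induction with
    | mem a ha => exact hg a ha
    | zero => simp
    | add p q _ _ hp hq => rw [map_add, hp, hq]
    | smul n p _ hp => rw [map_zsmul, hp]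
  have hspanO : Submodule.span ℝ O = ⊤ := by
    rw [eq_top_iff, ← hspan, Submodule.span_le]
    intro x hx
    have hx : x ∈ R := hx
    rw [← hO] at hx
    exact Submodule.span_subset_span ℤ ℝ O hx
  by_cases hd : ∃ u ∈ O, v₀ ≠ u ∧ B v₀ u = 1
  · right
    obtain ⟨u, huO, hvu, hB⟩ := hd
    have hBu : B u v₀ = 1 := by rw [hsymm, hB]
    have hsub : ({u, v₀} : Set V) ⊆ O := by
      rintro x (rfl | rfl) <;> assumption
    have hOeq : O = {u, v₀} := by
      refine Set.Subset.antisymm (hsplit _ hsub (by simp) ?_) hsub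
      intro a ha b hb hbn
      simp only [Set.mem_insert_iff, Set.mem_singleton_iff, not_or] at hbn
      rcases ha with rfl | rfl
      · rcases hpair a huO b hb (Ne.symm hbn.1) with h | h
        · exact h
        · exact (huniq a huO v₀ hv₀O b hb hvu.symm (Ne.symm hbn.1) (Ne.symm hbn.2) hBu h).elim
      · rcases hpair a hv₀O b hb (Ne.symm hbn.2) with h | h
        · exact h
        · exact (huniq a hv₀O u huO b hb hvu (Ne.symm hbn.2) (Ne.symm hbn.1) hB h).elim
    obtain ⟨σ, hσ⟩ := id huO
    have hmem : ∀ x ∈ O, x = u ∨ x = v₀ := by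
      intro x hx
      rw [hOeq] at hx
      exact hx
    have hσu : ρ σ u = v₀ := by
      rcases hmem _ (hgO σ u huO) with h | h
      · exact absurd ((ρ σ).injective (h.trans hσ)) hvu.symm
      · exact h
    have hσ1 : σ ≠ 1 := by
      rintro rfl
      apply hvu
      rw [hσ]; simp
    have hfix1 : ∀ g : G, ρ g v₀ = v₀ → g = 1 := by
      intro g hg
      apply hfaithO
      intro x hx
      rcases hmem x hx with rfl | rfl
      · rcases hmem _ (hgO g x huO) with h | h
        · exact h
        · exact absurd ((ρ g).injective (h.trans hg.symm)) (Ne.symm hvu)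
      · exact hg
    have hall : ∀ g : G, g = 1 ∨ g = σ := by
      intro g
      rcases hmem _ (hgO g v₀ hv₀O) with h | h
      · right
        have h1 : σ⁻¹ * g = 1 := by
          apply hfix1
          rw [map_mul]
          change ρ σ⁻¹ (ρ g v₀) = v₀
          rw [h, hσ, hinv]
        exact (inv_mul_eq_one.1 h1).symm
      · left; exact hfix1 g h
    have hli : LinearIndependent ℝ ![u, v₀] := by
      rw [LinearIndependent.pair_iff]
      intro s t hst
      have h1 : B u (s • u + t • v₀) = 0 := by rw [hst]; simp
      have h2 : B v₀ (s • u + t • v₀) = 0 := by rw [hst]; simp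
      simp only [map_add, map_smul, smul_eq_mul, hOroot u huO, hBu, hB, hv₀] at h1 h2
      constructor <;> linarith
    refine ⟨?_, u, v₀, hOR u huO, hv₀R, hOroot u huO, hv₀, hBu, ?_, ?_, σ, hσ1, hσu, hσ.symm⟩
    · have h1 := finrank_span_eq_card hli
      have h2 : Set.range ![u, v₀] = O := by
        rw [hOeq]; simp [Set.pair_comm]
      rw [h2, hspanO, finrank_top] at h1
      simpa using h1
    · rw [← hOeq, hO]
    · rw [Nat.card_eq_two_iff]
      refine ⟨1, σ, hσ1.symm, ?_⟩
      ext g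
      simpa using hall g
  · left
    push Not at hd
    have hsub : ({v₀} : Set V) ⊆ O := by
      rintro x rfl; assumption
    have hOeq : O = {v₀} := by
      refine Set.Subset.antisymm (hsplit _ hsub (by simp) ?_) hsub
      rintro a rfl b hb hbn
      have hne : a ≠ b := fun h => hbn (by simp [h])
      rcases hpair a hv₀O b hb hne with h | h
      · exact h
      · exact absurd h (hd b hb hne)
    refine ⟨?_, ?_⟩
    · have h1 := finrank_span_singleton (K := ℝ) (hOne v₀ hv₀O)
      rwa [← hOeq, hspanO, finrank_top] at h1
    · intro g
      apply hfaithO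
      intro x hx
      have h1 := hgO g x hx
      rw [hOeq] at h1 hx
      rw [h1, hx]
end

section
/- Let M be a nondegenerate integral lattice whose real form on M ⊗ ℝ has signature (1, rank M − 1) (hyperbolic), and let u₁, u₂ ∈ M satisfy u₁² = u₂² = 0 and u₁·u₂ > 0. Then for every integer a, the set {v ∈ M : v² = a and there exist real numbers s > 0, t > 0 with v·(s u₁ + t u₂) = 0} is finite. -/
/-- In a nondegenerate hyperbolic integral lattice `M` (signature
`(1, rank M − 1)`, realized as a full lattice in `V = M ⊗ ℝ`), given isotropic vectors
`u₁, u₂ ∈ M` with `u₁·u₂ > 0`, for every integer `a` there are only finitely many `v ∈ M`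
with `v² = a` whose orthogonal hyperplane meets the open line segment spanned by positive
combinations of `u₁` and `u₂`. -/
theorem stmt_9
    {V : Type*} [AddCommGroup V] [Module ℝ V] [FiniteDimensional ℝ V]
    (B : V →ₗ[ℝ] V →ₗ[ℝ] ℝ)
    (hsymm : ∀ x y : V, B x y = B y x)
    (hnondeg : ∀ x : V, (∀ y : V, B x y = 0) → x = 0)
    -- signature (1, rank − 1): there is a positive vector, and no positive definite
    -- subspace of dimension ≥ 2
    (hpos : ∃ x : V, 0 < B x x)
    (hposmax : ∀ p : Submodule ℝ V,
      (∀ x ∈ p, x ≠ 0 → 0 < B x x) → Module.finrank ℝ p ≤ 1)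
    (M : Submodule ℤ V)
    (hfg : M.FG)
    (hspan : Submodule.span ℝ (M : Set V) = ⊤)
    (hint : ∀ x ∈ M, ∀ y ∈ M, ∃ n : ℤ, B x y = (n : ℝ))
    (u₁ u₂ : V) (hu₁ : u₁ ∈ M) (hu₂ : u₂ ∈ M)
    (hu₁sq : B u₁ u₁ = 0) (hu₂sq : B u₂ u₂ = 0) (hu₁u₂ : 0 < B u₁ u₂)
    (a : ℤ) :
    {v : V | v ∈ M ∧ B v v = (a : ℝ) ∧
      ∃ s t : ℝ, 0 < s ∧ 0 < t ∧ B v (s • u₁ + t • u₂) = 0}.Finite := by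
  have h21 : B u₂ u₁ = B u₁ u₂ := hsymm _ _
  -- negative semidefiniteness on the orthogonal complement of u₁, u₂
  have hneg : ∀ w : V, B w u₁ = 0 → B w u₂ = 0 → B w w ≤ 0 := by
    intro w h1 h2
    by_contra! hw
    have h1' : B u₁ w = 0 := by rw [hsymm, h1]
    have h2' : B u₂ w = 0 := by rw [hsymm, h2]
    have key : ∀ x y : ℝ, B (x • (u₁ + u₂) + y • w) (x • (u₁ + u₂) + y • w)
        = 2 * x ^ 2 * B u₁ u₂ + y ^ 2 * B w w := by
      intro x y
      simp only [map_add, map_smul, LinearMap.add_apply, LinearMap.smul_apply, smul_eq_mul,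
        h1, h2, h1', h2', hu₁sq, hu₂sq, h21]
      ring
    have hli : LinearIndependent ℝ ![u₁ + u₂, w] := by
      rw [LinearIndependent.pair_iff]
      intro x y hxy
      have h := key x y
      rw [hxy] at h
      simp only [map_zero] at h
      have ha : 0 ≤ 2 * x ^ 2 * B u₁ u₂ := by positivity
      have hb : 0 ≤ y ^ 2 * B w w := by positivity
      have ha' : 2 * x ^ 2 * B u₁ u₂ = 0 := by linarith
      have hb' : y ^ 2 * B w w = 0 := by linarith
      constructor
      · simpa [hu₁u₂.ne'] using ha'
      · simpa [hw.ne'] using hb'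
    have hfr := finrank_span_eq_card hli
    have hle := hposmax (Submodule.span ℝ (Set.range ![u₁ + u₂, w])) (by
      intro z hz hz0
      rw [Matrix.range_cons, Matrix.range_cons, Matrix.range_empty, Set.union_empty,
        Set.singleton_union, Submodule.mem_span_pair] at hz
      obtain ⟨x, y, rfl⟩ := hz
      rw [key]
      have ha : 0 ≤ 2 * x ^ 2 * B u₁ u₂ := by positivity
      have hb : 0 ≤ y ^ 2 * B w w := by positivity
      by_cases hx : x = 0
      · have hy : y ≠ 0 := by
          rintro rfl
          simp [hx] at hz0
        have : 0 < y ^ 2 * B w w := by positivity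
        linarith
      · have : 0 < 2 * x ^ 2 * B u₁ u₂ := by positivity
        linarith)
    rw [hfr] at hle
    simp at hle
  set c := B u₁ u₂ with hc
  -- orthogonal projection
  have hproj : ∀ v : V, ∃ w : V, v = (B v u₂ / c) • u₁ + (B v u₁ / c) • u₂ + w ∧
      B w u₁ = 0 ∧ B w u₂ = 0 := by
    intro v
    refine ⟨v - ((B v u₂ / c) • u₁ + (B v u₁ / c) • u₂), by abel, ?_, ?_⟩
    · simp only [map_add, map_sub, map_smul, LinearMap.add_apply, LinearMap.sub_apply,
        LinearMap.smul_apply, smul_eq_mul, hu₁sq, hu₂sq, h21]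
      field_simp
      ring
    · simp only [map_add, map_sub, map_smul, LinearMap.add_apply, LinearMap.sub_apply,
        LinearMap.smul_apply, smul_eq_mul, hu₁sq, hu₂sq, ← hc]
      field_simp
      ring
  have hbilin : ∀ v v' w w' : V, ∀ p q p' q' : ℝ, v = (q / c) • u₁ + (p / c) • u₂ + w →
      v' = (q' / c) • u₁ + (p' / c) • u₂ + w' → B w u₁ = 0 → B w u₂ = 0 →
      B w' u₁ = 0 → B w' u₂ = 0 → B v v' = (p * q' + q * p') / c + B w w' := by
    intro v v' w w' p q p' q' hv hv' h1 h2 h3 h4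
    have h3' : B u₁ w' = 0 := by rw [hsymm, h3]
    have h4' : B u₂ w' = 0 := by rw [hsymm, h4]
    rw [hv, hv']
    simp only [map_add, map_smul, LinearMap.add_apply, LinearMap.smul_apply, smul_eq_mul,
        h1, h2, h3', h4', hu₁sq, hu₂sq, h21, ← hc]
    field_simp
    ring
  have hbound : ∀ m : V, ∃ C : ℝ, ∀ v : V, v ∈ M → B v v = (a : ℝ) →
      (∃ s t : ℝ, 0 < s ∧ 0 < t ∧ B v (s • u₁ + t • u₂) = 0) → |B v m| ≤ C := by
    intro m
    obtain ⟨m', hm, hm1, hm2⟩ := hproj m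
    refine ⟨(|(a : ℝ)| * c * |B m u₂| + |(a : ℝ)| * c * |B m u₁|) / c + (|(a : ℝ)| - B m' m'), ?_⟩
    rintro v hv hva ⟨s, t, hs, ht, hst⟩
    obtain ⟨w, hw, hw1, hw2⟩ := hproj v
    have e1 := hbilin v v w w _ _ _ _ hw hw hw1 hw2 hw1 hw2
    have e2 := hbilin v m w m' _ _ _ _ hw hm hw1 hw2 hm1 hm2
    obtain ⟨p, hp⟩ := hint v hv u₁ hu₁
    obtain ⟨q, hq⟩ := hint v hv u₂ hu₂
    have hww := hneg w hw1 hw2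
    simp only [map_add, map_smul, smul_eq_mul] at hst
    rw [hva] at e1
    rw [hp, hq] at e1 e2 hst
    have hA : -(a : ℝ) ≤ |(a : ℝ)| := neg_le_abs _
    have hA0 : 0 ≤ |(a : ℝ)| := abs_nonneg _
    have hpq : (p : ℝ) * q ≤ 0 := by
      have : s * ((p : ℝ) * q) = -(t * (q : ℝ) ^ 2) := by linear_combination (q : ℝ) * hst
      have h0 : 0 ≤ t * (q : ℝ) ^ 2 := by positivity
      by_contra! hh
      have := mul_pos hs hh
      linarith
    have hpqc : ((p : ℝ) * q + q * p) / c ≤ 0 := div_nonpos_of_nonpos_of_nonneg (by linarith) hu₁u₂.le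
    have hpqa : -((p : ℝ) * q) ≤ |(a : ℝ)| * c := by
      have h1 : (a : ℝ) ≤ ((p : ℝ) * q + q * p) / c := by linarith
      rw [le_div_iff₀ hu₁u₂] at h1
      nlinarith [mul_le_mul_of_nonneg_right hA hu₁u₂.le, mul_nonneg hA0 hu₁u₂.le]
    have hpqb : |(p : ℝ)| ≤ |(a : ℝ)| * c ∧ |(q : ℝ)| ≤ |(a : ℝ)| * c := by
      by_cases hp0 : p = 0
      · have hq0 : (q : ℝ) = 0 := by
          simpa [hp0, ht.ne'] using hst
        rw [hq0, hp0]
        simp only [Int.cast_zero, abs_zero, and_self]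
        positivity
      · have hq0 : q ≠ 0 := by
          rintro rfl
          apply hp0
          simpa [hs.ne'] using hst
        have hp1 : (1 : ℝ) ≤ |(p : ℝ)| := by exact_mod_cast Int.one_le_abs hp0
        have hq1 : (1 : ℝ) ≤ |(q : ℝ)| := by exact_mod_cast Int.one_le_abs hq0
        have : |(p : ℝ)| * |(q : ℝ)| ≤ |(a : ℝ)| * c := by
          rw [← abs_mul, abs_of_nonpos hpq]; exact hpqa
        constructor <;> nlinarith
    have hwm : |B w m'| ≤ |(a : ℝ)| - B m' m' := by
      have hmm := hneg m' hm1 hm2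
      have g1 := hneg (w + m') (by simp [hw1, hm1]) (by simp [hw2, hm2])
      have g2 := hneg (w - m') (by simp [hw1, hm1]) (by simp [hw2, hm2])
      simp only [map_add, map_sub, LinearMap.add_apply, LinearMap.sub_apply, hsymm m' w] at g1 g2
      rw [abs_le]
      constructor <;> linarith
    rw [e2]
    refine (abs_add_le _ _).trans (add_le_add ?_ hwm)
    rw [abs_div, abs_of_pos hu₁u₂]
    refine div_le_div_of_nonneg_right ((abs_add_le _ _).trans ?_) hu₁u₂.le
    rw [abs_mul, abs_mul]
    exact add_le_add (mul_le_mul_of_nonneg_right hpqb.1 (abs_nonneg _))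
      (mul_le_mul_of_nonneg_right hpqb.2 (abs_nonneg _))
  choose C hC using hbound
  obtain ⟨S, hS⟩ := hfg
  have hSM : ∀ g ∈ S, g ∈ M := fun g hg => hS ▸ Submodule.subset_span hg
  have hfin : ∀ r : ℝ, {x : ℝ | ∃ n : ℤ, x = n ∧ |x| ≤ r}.Finite := by
    intro r
    refine ((Set.finite_Icc (-⌈r⌉) ⌈r⌉).image (fun n : ℤ => (n : ℝ))).subset ?_
    rintro x ⟨n, rfl, hn⟩
    refine ⟨n, ?_, rfl⟩
    have hn' := abs_le.1 (hn.trans (Int.le_ceil r))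
    exact ⟨by exact_mod_cast hn'.1, by exact_mod_cast hn'.2⟩
  refine Set.Finite.of_finite_image (f := fun v : V => fun g : S => B v g) ?_ ?_
  · refine (Set.Finite.pi' (fun g : S => hfin (C g))).subset ?_
    rintro _ ⟨v, ⟨hv, hva, hst⟩, rfl⟩ g
    obtain ⟨n, hn⟩ := hint v hv g (hSM g g.2)
    exact ⟨n, hn, hC g v hv hva hst⟩
  · intro v _ v' _ hvv
    have h0 : v - v' = 0 := by
      apply hnondeg
      have hker : M ≤ (LinearMap.ker (B (v - v'))).restrictScalars ℤ := by
        rw [← hS, Submodule.span_le]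
        intro g hg
        have := congrFun hvv ⟨g, hg⟩
        simp only at this
        simp [this]
      have hk : (⊤ : Submodule ℝ V) ≤ LinearMap.ker (B (v - v')) := by
        rw [← hspan, Submodule.span_le]
        exact hker
      intro y
      exact hk (Submodule.mem_top (x := y))
    exact sub_eq_zero.1 h0
end

section
/- Let M be a nondegenerate integral lattice whose real form on M ⊗ ℝ has signature (1, rank M − 1). Let F ⊂ M ⊗ ℚ be a finite set of vectors such that x² ≥ 0 and x·y ≥ 0 for all x, y ∈ F, and let Q = {Σ_{x ∈ F} c_x x : c_x ∈ ℝ, c_x ≥ 0 for all x ∈ F} ∩ {z ∈ M ⊗ ℝ : z² > 0} (the cone over a polyhedron in the hyperbolic space of M ⊗ ℝ whose closure is the convex hull of finitely many rational points). Then for every integer a, the set {v ∈ M : v² = a and v·z = 0 for some z ∈ Q} is finite. -/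
section Helpers
variable {V : Type*} [AddCommGroup V] [Module ℝ V]

theorem aux_semidef (B : V →ₗ[ℝ] V →ₗ[ℝ] ℝ)
    (hsymm : ∀ x y : V, B x y = B y x)
    (hposmax : ∀ p : Submodule ℝ V,
      (∀ x ∈ p, x ≠ 0 → 0 < B x x) → Module.finrank ℝ p ≤ 1)
    (h w : V) (hh : 0 < B h h) (hw : B h w = 0) : B w w ≤ 0 := by
  by_contra hcon
  push Not at hcon
  have hwh : B w h = 0 := by rw [hsymm, hw]
  have key : ∀ s t : ℝ, B (s • h + t • w) (s • h + t • w) = s ^ 2 * B h h + t ^ 2 * B w w := by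
    intro s t
    simp [hw, hwh]
    ring
  have hli : LinearIndependent ℝ ![h, w] := by
    rw [LinearIndependent.pair_iff]
    intro s t hst
    have h1 := key s t
    rw [hst] at h1
    simp only [map_zero] at h1
    have h2 : 0 ≤ s ^ 2 * B h h := by positivity
    have h3 : 0 ≤ t ^ 2 * B w w := by positivity
    have h4 : s ^ 2 * B h h = 0 := by linarith
    have h5 : t ^ 2 * B w w = 0 := by linarith
    constructor
    · simpa [hh.ne'] using h4
    · simpa [hcon.ne'] using h5
  have := hposmax (Submodule.span ℝ (Set.range ![h, w])) (by
    intro x hx hx0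
    simp only [Matrix.range_cons, Matrix.range_empty, Set.union_empty, Set.singleton_union] at hx
    rw [Submodule.mem_span_pair] at hx
    obtain ⟨s, t, rfl⟩ := hx
    rw [key]
    by_cases hs : s = 0
    · have ht : t ≠ 0 := by
        rintro rfl
        apply hx0
        simp [hs]
      have : 0 < t ^ 2 * B w w := by positivity
      have h2 : 0 ≤ s ^ 2 * B h h := by positivity
      linarith
    · have : 0 < s ^ 2 * B h h := by positivity
      have h2 : 0 ≤ t ^ 2 * B w w := by positivity
      linarith)
  rw [finrank_span_eq_card hli] at this
  simp at this

theorem aux_def (B : V →ₗ[ℝ] V →ₗ[ℝ] ℝ)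
    (hsymm : ∀ x y : V, B x y = B y x)
    (hnondeg : ∀ x : V, (∀ y : V, B x y = 0) → x = 0)
    (hposmax : ∀ p : Submodule ℝ V,
      (∀ x ∈ p, x ≠ 0 → 0 < B x x) → Module.finrank ℝ p ≤ 1)
    (h w : V) (hh : 0 < B h h) (hw : B h w = 0) (hww : 0 ≤ B w w) : w = 0 := by
  have h0 : B w w = 0 := le_antisymm (aux_semidef B hsymm hposmax h w hh hw) hww
  have hwh : B w h = 0 := by rw [hsymm, hw]
  apply hnondeg
  intro y
  by_contra hy
  set y' : V := B h h • y - B h y • h with hy'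
  have hhy' : B h y' = 0 := by
    simp [hy']
    ring
  have hwy' : B w y' = B h h * B w y := by simp [hy', hwh]
  have hne : B w y' ≠ 0 := by rw [hwy']; exact mul_ne_zero hh.ne' hy
  set t : ℝ := (1 - B y' y') / (2 * B w y') with ht
  have h1 : B (y' + t • w) (y' + t • w) = 1 := by
    have h2 : B (y' + t • w) (y' + t • w) = B y' y' + 2 * t * B w y' := by
      simp [h0, hsymm y' w]
      ring
    rw [h2, ht]
    field_simp
    ring
  have h3 := aux_semidef B hsymm hposmax h (y' + t • w) hh (by simp [hhy', hw])
  linarith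

theorem aux_revCS (B : V →ₗ[ℝ] V →ₗ[ℝ] ℝ)
    (hsymm : ∀ x y : V, B x y = B y x)
    (hposmax : ∀ p : Submodule ℝ V,
      (∀ x ∈ p, x ≠ 0 → 0 < B x x) → Module.finrank ℝ p ≤ 1)
    (u w : V) (hu : 0 < B u u) : B u u * B w w ≤ (B u w) ^ 2 := by
  have h1 := aux_semidef B hsymm hposmax u (B u u • w - B u w • u) hu (by
    simp
    ring)
  have h2 : B (B u u • w - B u w • u) (B u u • w - B u w • u)
      = B u u * (B u u * B w w - (B u w) ^ 2) := by
    simp [hsymm w u]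
    ring
  rw [h2] at h1
  by_contra hc
  push Not at hc
  have : 0 < B u u * (B u u * B w w - (B u w) ^ 2) := mul_pos hu (by linarith)
  linarith

theorem aux_finite (B : V →ₗ[ℝ] V →ₗ[ℝ] ℝ)
    (hsymm : ∀ x y : V, B x y = B y x)
    (hnondeg : ∀ x : V, (∀ y : V, B x y = 0) → x = 0)
    (hposmax : ∀ p : Submodule ℝ V,
      (∀ x ∈ p, x ≠ 0 → 0 < B x x) → Module.finrank ℝ p ≤ 1)
    (M : Submodule ℤ V)
    (hfg : M.FG)
    (hspan : Submodule.span ℝ (M : Set V) = ⊤)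
    (hint : ∀ x ∈ M, ∀ y ∈ M, ∃ n : ℤ, B x y = (n : ℝ))
    (a C : ℝ) (h : V) (hh : 0 < B h h) :
    {v : V | v ∈ M ∧ B v v = a ∧ |B h v| ≤ C}.Finite := by
  have hbd : ∀ m : V, ∃ K : ℝ, ∀ v : V, B v v = a → |B h v| ≤ C → |B v m| ≤ K := by
    intro m
    have hk0 : (B h h) ≠ 0 := hh.ne'
    set k := B h h with hk
    have e1 : ∀ x : V, B h (x - (B h x / k) • h) = 0 := by
      intro x
      simp [← hk]
      field_simp
      ring
    have e2 : ∀ x y : V, B (x - (B h x / k) • h) (y - (B h y / k) • h)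
        = B x y - B h x * B h y / k := by
      intro x y
      simp [← hk, hsymm x h]
      field_simp
      ring
    have key : ∀ v : V, 2 * |B v m - B h v * B h m / k| ≤
        ((B h v) ^ 2 / k - B v v) + ((B h m) ^ 2 / k - B m m) := by
      intro v
      set v' := v - (B h v / k) • h with hv'
      set m' := m - (B h m / k) • h with hm'
      have f1 := aux_semidef B hsymm hposmax h (v' + m') hh (by rw [map_add, e1, e1]; simp)
      have f2 := aux_semidef B hsymm hposmax h (v' - m') hh (by rw [map_sub, e1, e1]; simp)
      simp only [map_add, map_sub, LinearMap.add_apply, LinearMap.sub_apply] at f1 f2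
      rw [hsymm m' v'] at f1 f2
      have g1 : B v' m' = _ := e2 v m
      have g2 : B v' v' = _ := e2 v v
      have g3 : B m' m' = _ := e2 m m
      rw [g1, g2, g3] at f1 f2
      have : |B v m - B h v * B h m / k| ≤
        (((B h v) ^ 2 / k - B v v) + ((B h m) ^ 2 / k - B m m)) / 2 := by
        rw [abs_le, pow_two, pow_two]
        constructor <;> linarith
      linarith
    refine ⟨(C ^ 2 / k - a) + ((B h m) ^ 2 / k - B m m) + C * |B h m| / k, ?_⟩
    intro v hva hvC
    have h1 := key v
    rw [hva] at h1
    have h2 : (B h v) ^ 2 ≤ C ^ 2 := by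
      rw [← sq_abs]
      exact pow_le_pow_left₀ (abs_nonneg _) hvC 2
    have h3 : (B h v) ^ 2 / k ≤ C ^ 2 / k := by gcongr
    have h4 : |B h v * B h m / k| ≤ C * |B h m| / k := by
      rw [abs_div, abs_mul, abs_of_pos hh]
      gcongr
    have h5 : |B v m| ≤ |B v m - B h v * B h m / k| + |B h v * B h m / k| := by
      have := abs_add_le (B v m - B h v * B h m / k) (B h v * B h m / k)
      simpa using this
    have h6 := abs_nonneg (B v m - B h v * B h m / k)
    linarith
  choose K hK using hbd
  obtain ⟨G, hG⟩ := hfg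
  have hGM : ∀ g ∈ G, g ∈ M := fun g hg => by
    rw [← hG]; exact Submodule.subset_span hg
  let f : V → (G → ℤ) := fun v g => ⌊B v g⌋
  have hf : ∀ v ∈ M, ∀ g : G, ((f v g : ℤ) : ℝ) = B v g := by
    intro v hv g
    obtain ⟨n, hn⟩ := hint v hv g (hGM g g.2)
    simp [f, hn]
  apply Set.Finite.of_finite_image (f := f)
  · apply Set.Finite.subset (Set.Finite.pi (t := fun g : G => Set.Icc (-⌈K g⌉) ⌈K g⌉)
      (fun g => Set.finite_Icc _ _))
    rintro _ ⟨v, ⟨hvM, hva, hvC⟩, rfl⟩ g -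
    have h1 := hK g v hva hvC
    rw [← hf v hvM g, abs_le] at h1
    have h2 := Int.le_ceil (K g)
    constructor
    · have : (-(⌈K g⌉ : ℝ)) ≤ (f v g : ℝ) := by linarith
      exact_mod_cast this
    · have : (f v g : ℝ) ≤ (⌈K g⌉ : ℝ) := by linarith
      exact_mod_cast this
  · rintro v ⟨hv, -, -⟩ w ⟨hw, -, -⟩ hvw
    have h1 : ∀ g ∈ G, B (v - w) g = 0 := by
      intro g hg
      have e1 := hf v hv ⟨g, hg⟩
      have e2 := hf w hw ⟨g, hg⟩
      rw [hvw, e2] at e1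
      simp only at e1
      simp [e1]
    have h2 : ∀ m ∈ M, B (v - w) m = 0 := by
      intro m hm
      rw [← hG] at hm
      induction hm using Submodule.span_induction with
      | mem x hx => exact h1 x hx
      | zero => simp
      | add x y _ _ hx hy => rw [map_add, hx, hy, add_zero]
      | smul c x _ hx => rw [map_zsmul, hx, smul_zero]
    have h3 : v - w = 0 := by
      apply hnondeg
      intro y
      have hy : y ∈ Submodule.span ℝ (M : Set V) := by rw [hspan]; trivial
      induction hy using Submodule.span_induction with
      | mem x hx => exact h2 x hx
      | zero => simp
      | add x y _ _ hx hy => rw [map_add, hx, hy, add_zero]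
      | smul c x _ hx => rw [map_smul, hx, smul_zero]
    exact sub_eq_zero.mp h3

/-- The key estimate: a vector separating two points of the closed positive cone. -/
theorem aux_sep (B : V →ₗ[ℝ] V →ₗ[ℝ] ℝ)
    (hsymm : ∀ x y : V, B x y = B y x)
    (hnondeg : ∀ x : V, (∀ y : V, B x y = 0) → x = 0)
    (hposmax : ∀ p : Submodule ℝ V,
      (∀ x ∈ p, x ≠ 0 → 0 < B x x) → Module.finrank ℝ p ≤ 1)
    (h v p n : V) (hh : 0 < B h h) (hp : 0 ≤ B p p) (hn : 0 ≤ B n n) (hpn : 0 ≤ B p n)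
    (hhp : 0 ≤ B h p) (hhn : 0 ≤ B h n) (hv : B v v < 0)
    (hvp : 0 < B v p) (hvn : B v n < 0) : B v v * B p n ≤ 2 * (B v p * B v n) := by
  have hp0 : p ≠ 0 := by rintro rfl; simp at hvp
  have hn0 : n ≠ 0 := by rintro rfl; simp at hvn
  have hhp' : 0 < B h p := by
    refine lt_of_le_of_ne hhp fun hc => hp0 ?_
    exact aux_def B hsymm hnondeg hposmax h p hh hc.symm hp
  have hpn' : 0 < B p n := by
    refine lt_of_le_of_ne hpn fun hc => ?_
    have hw := aux_def B hsymm hnondeg hposmax h (B h n • p - B h p • n) hh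
      (by simp; ring) (by
        have : B (B h n • p - B h p • n) (B h n • p - B h p • n)
          = (B h n) ^ 2 * B p p + (B h p) ^ 2 * B n n := by
          simp [hsymm n p, ← hc]
          ring
        rw [this]
        positivity)
    have h1 : B v (B h n • p - B h p • n) = 0 := by rw [hw, map_zero]
    simp only [map_sub, map_smul, smul_eq_mul] at h1
    have h2 : 0 ≤ B h n * B v p := by positivity
    have h3 : B h p * B v n < 0 := mul_neg_of_pos_of_neg hhp' hvn
    linarith
  have e : ∀ x y : V, B (B v v • x - B v x • v) (B v v • y - B v y • v)
      = (B v v) ^ 2 * B x y - B v v * (B v x * B v y) := by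
    intro x y
    simp [hsymm x v]
    ring
  set A := B v v with hA
  have hP : 0 < A ^ 2 * B p p - A * (B v p * B v p) := by
    have h1 : 0 ≤ A ^ 2 * B p p := by positivity
    have h2 : A * (B v p * B v p) < 0 := mul_neg_of_neg_of_pos hv (by positivity)
    linarith
  have h1 := aux_revCS B hsymm hposmax (A • p - B v p • v) (A • n - B v n • v)
    (by rw [e]; exact hP)
  rw [e, e, e] at h1
  generalize B v p = α at *
  generalize B v n = γ at *
  generalize B p n = r at *
  generalize B p p = s at *
  generalize B n n = t at *
  have h3 : (A * (α * γ)) ^ 2 ≤ (A ^ 2 * s - A * (α * α)) * (A ^ 2 * t - A * (γ * γ)) := by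
    have g1 : 0 ≤ A ^ 2 * s := by positivity
    have g2 : 0 ≤ A ^ 2 * t := by positivity
    have g3 : 0 ≤ -A * (α * α) := mul_nonneg (by linarith) (mul_self_nonneg _)
    have g4 : 0 ≤ -A * (γ * γ) := mul_nonneg (by linarith) (mul_self_nonneg _)
    nlinarith [mul_nonneg g1 g2, mul_nonneg g1 g4, mul_nonneg g3 g2]
  have h4 : 0 ≤ (A ^ 2 * r) * (-A) * (2 * (α * γ) - A * r) := by nlinarith
  by_contra hc
  push Not at hc
  have : 0 < (A ^ 2 * r) * (-A) := by
    have : 0 < -A := by linarith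
    have : A ≠ 0 := hv.ne
    positivity
  have := mul_pos this (show 0 < -(2 * (α * γ) - A * r) by linarith)
  linarith

theorem aux_sumpos (B : V →ₗ[ℝ] V →ₗ[ℝ] ℝ) (S : Finset V)
    (hS : ∀ x ∈ S, ∀ y ∈ S, 0 ≤ B x y) (c : V → ℝ)
    (hz : 0 < B (∑ x ∈ S, c x • x) (∑ x ∈ S, c x • x)) :
    0 < B (∑ x ∈ S, x) (∑ x ∈ S, x) := by
  have e : B (∑ x ∈ S, x) (∑ x ∈ S, x) = ∑ x ∈ S, ∑ y ∈ S, B x y := by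
    simp [map_sum, LinearMap.sum_apply]
    exact Finset.sum_comm
  rw [e]
  refine lt_of_le_of_ne (Finset.sum_nonneg fun x hx => Finset.sum_nonneg fun y hy => hS x hx y hy) ?_
  intro h0
  have h1 : ∀ x ∈ S, ∀ y ∈ S, B x y = 0 := by
    intro x hx y hy
    have := (Finset.sum_eq_zero_iff_of_nonneg
      (fun x hx => Finset.sum_nonneg fun y hy => hS x hx y hy)).1 h0.symm x hx
    exact (Finset.sum_eq_zero_iff_of_nonneg (fun y hy => hS x hx y hy)).1 this y hy
  apply hz.ne'
  simp only [map_sum, LinearMap.sum_apply, map_smul, LinearMap.smul_apply]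
  refine Finset.sum_eq_zero fun x hx => ?_
  rw [Finset.sum_eq_zero fun y hy => by rw [h1 y hy x hx, smul_zero], smul_zero]

/-- If all `v·x` have one sign, then `z` is supported on `v`-orthogonal elements. -/
theorem aux_support (B : V →ₗ[ℝ] V →ₗ[ℝ] ℝ) (F : Finset V) (c : V → ℝ) (hc : ∀ x, 0 ≤ c x)
    (v : V) (hv : B v (∑ x ∈ F, c x • x) = 0) (hs : ∀ x ∈ F, 0 ≤ B v x) :
    ∑ x ∈ F, c x • x = ∑ x ∈ F with B v x = 0, c x • x := by
  symm
  apply Finset.sum_subset (Finset.filter_subset _ _)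
  intro x hx hx'
  simp only [map_sum, map_smul, smul_eq_mul] at hv
  have h1 := (Finset.sum_eq_zero_iff_of_nonneg
    (fun x hx => mul_nonneg (hc x) (hs x hx))).1 hv x hx
  have h2 : B v x ≠ 0 := fun h => hx' (Finset.mem_filter.2 ⟨hx, h⟩)
  have h3 : c x = 0 := by simpa [h2] using h1
  simp [h3]

end Helpers


/-- In a nondegenerate hyperbolic integral lattice `M` (signature
`(1, rank M − 1)`, realized as a full lattice in `V = M ⊗ ℝ`), let `F` be a finite set
of rational vectors (vectors with a nonzero integer multiple in `M`) with `x² ≥ 0` and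
`x·y ≥ 0` for all `x, y ∈ F`, and let `Q` be the set of nonnegative combinations of `F`
of positive square.  Then for every integer `a` there are only finitely many `v ∈ M` with
`v² = a` orthogonal to some point of `Q`. -/
theorem stmt_10
    {V : Type*} [AddCommGroup V] [Module ℝ V] [FiniteDimensional ℝ V]
    (B : V →ₗ[ℝ] V →ₗ[ℝ] ℝ)
    (hsymm : ∀ x y : V, B x y = B y x)
    (hnondeg : ∀ x : V, (∀ y : V, B x y = 0) → x = 0)
    (hpos : ∃ x : V, 0 < B x x)
    (hposmax : ∀ p : Submodule ℝ V,
      (∀ x ∈ p, x ≠ 0 → 0 < B x x) → Module.finrank ℝ p ≤ 1)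
    (M : Submodule ℤ V)
    (hfg : M.FG)
    (hspan : Submodule.span ℝ (M : Set V) = ⊤)
    (hint : ∀ x ∈ M, ∀ y ∈ M, ∃ n : ℤ, B x y = (n : ℝ))
    (F : Finset V)
    -- the points of `F` are rational, i.e. lie in `M ⊗ ℚ`
    (hrat : ∀ x ∈ F, ∃ n : ℤ, n ≠ 0 ∧ (n : ℤ) • x ∈ M)
    (hFpos : ∀ x ∈ F, 0 ≤ B x x)
    (hFdot : ∀ x ∈ F, ∀ y ∈ F, 0 ≤ B x y)
    (a : ℤ) :
    {v : V | v ∈ M ∧ B v v = (a : ℝ) ∧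
      ∃ z : V, ((∃ c : V → ℝ, (∀ x, 0 ≤ c x) ∧ z = ∑ x ∈ F, c x • x) ∧ 0 < B z z) ∧
        B v z = 0}.Finite := by
  classical
  -- a uniform lower bound for nonzero values
  have hδ : ∃ δ : ℝ, 0 < δ ∧ ∀ v ∈ M, ∀ x ∈ F, B v x ≠ 0 → δ ≤ |B v x| := by
    have h1 : ∀ x ∈ F, ∃ δ : ℝ, 0 < δ ∧ ∀ v ∈ M, B v x ≠ 0 → δ ≤ |B v x| := by
      intro x hx
      obtain ⟨n, hn, hnx⟩ := hrat x hx
      have hn' : (0 : ℝ) < |(n : ℝ)| := abs_pos.2 (by exact_mod_cast hn)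
      refine ⟨1 / |(n : ℝ)|, by positivity, fun v hv hvx => ?_⟩
      obtain ⟨k, hk⟩ := hint v hv _ hnx
      rw [map_zsmul, zsmul_eq_mul] at hk
      have hk0 : k ≠ 0 := by
        rintro rfl
        have : (n : ℝ) ≠ 0 := by exact_mod_cast hn
        simp [this, hvx] at hk
      have h2 : (1 : ℝ) ≤ |(k : ℝ)| := by exact_mod_cast Int.one_le_abs hk0
      rw [← hk, abs_mul] at h2
      rw [div_le_iff₀ hn']
      linarith
    choose! d hd0 hd using h1
    rcases F.eq_empty_or_nonempty with rfl | hne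
    · exact ⟨1, one_pos, by simp⟩
    · obtain ⟨x0, hx0, hmin⟩ := F.exists_min_image d hne
      exact ⟨d x0, hd0 x0 hx0, fun v hv x hx hvx => (hmin x hx).trans (hd x hx v hv hvx)⟩
  obtain ⟨δ, hδ0, hδ⟩ := hδ
  -- a uniform bound for the products in `F`
  set R : ℝ := ∑ x ∈ F, ∑ y ∈ F, B x y with hR
  have hRle : ∀ x ∈ F, ∀ y ∈ F, B x y ≤ R := by
    intro x hx y hy
    calc B x y ≤ ∑ y ∈ F, B x y := Finset.single_le_sum (fun y hy => hFdot x hx y hy) hy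
      _ ≤ R := Finset.single_le_sum (f := fun x => ∑ y ∈ F, B x y)
          (fun x hx => Finset.sum_nonneg fun y hy => hFdot x hx y hy) hx
  have hR0 : 0 ≤ R := Finset.sum_nonneg fun x hx => Finset.sum_nonneg fun y hy => hFdot x hx y hy
  set K : ℝ := |(a : ℝ)| * R / δ with hK
  have hK0 : 0 ≤ K := by positivity
  set C : ℝ := F.card * K with hC
  have hC0 : 0 ≤ C := by positivity
  let T : Finset (Finset V) := F.powerset.filter (fun S => 0 < B (∑ x ∈ S, x) (∑ x ∈ S, x))
  have hfin : (⋃ S ∈ T, {v : V | v ∈ M ∧ B v v = (a : ℝ) ∧ |B (∑ x ∈ S, x) v| ≤ C}).Finite := by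
    apply Set.Finite.biUnion T.finite_toSet
    intro S hS
    exact aux_finite B hsymm hnondeg hposmax M hfg hspan hint a C _
      (Finset.mem_filter.1 hS).2
  refine hfin.subset ?_
  rintro v ⟨hvM, hva, z, ⟨⟨c, hc, rfl⟩, hz⟩, hvz⟩
  simp only [Set.mem_iUnion]
  by_cases hcase : (∃ p ∈ F, 0 < B v p) ∧ (∃ n ∈ F, B v n < 0)
  · obtain ⟨⟨p, hp, hvp⟩, ⟨n, hn, hvn⟩⟩ := hcase
    have hh : 0 < B (∑ x ∈ F, x) (∑ x ∈ F, x) := aux_sumpos B F hFdot c hz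
    have hhF : ∀ y ∈ F, 0 ≤ B (∑ x ∈ F, x) y := by
      intro y hy
      rw [map_sum, LinearMap.sum_apply]
      exact Finset.sum_nonneg fun x hx => hFdot x hx y hy
    have hv0 : B v v < 0 := by
      by_contra hcon
      push Not at hcon
      have := aux_def B hsymm hnondeg hposmax _ v hz (by rw [hsymm]; exact hvz) hcon
      simp [this] at hvp
    have hsep : ∀ p ∈ F, ∀ n ∈ F, 0 < B v p → B v n < 0 →
        |B v p| * |B v n| ≤ |(a : ℝ)| * R := by
      intro p hp n hn hvp hvn
      have h1 := aux_sep B hsymm hnondeg hposmax _ v p n hh (hFpos p hp) (hFpos n hn)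
        (hFdot p hp n hn) (hhF p hp) (hhF n hn) hv0 hvp hvn
      have h2 := hRle p hp n hn
      rw [hva] at h1 hv0
      rw [abs_of_pos hvp, abs_of_neg hvn, abs_of_neg hv0]
      have h3 : -(a : ℝ) * B p n ≤ -(a : ℝ) * R :=
        mul_le_mul_of_nonneg_left h2 (by linarith)
      have h4 : 0 ≤ B v p * -B v n := mul_nonneg hvp.le (by linarith)
      linarith
    have hb : ∀ x ∈ F, |B v x| ≤ K := by
      intro x hx
      rcases lt_trichotomy (B v x) 0 with hneg | hzero | hps
      · have h1 := hsep p hp x hx hvp hneg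
        have h2 := hδ v hvM p hp hvp.ne'
        rw [hK, le_div_iff₀ hδ0]
        have := mul_le_mul_of_nonneg_left h2 (abs_nonneg (B v x))
        linarith
      · rw [hzero, abs_zero]; exact hK0
      · have h1 := hsep x hx n hn hps hvn
        have h2 := hδ v hvM n hn hvn.ne
        rw [hK, le_div_iff₀ hδ0]
        have := mul_le_mul_of_nonneg_left h2 (abs_nonneg (B v x))
        linarith
    refine ⟨F, Finset.mem_filter.2 ⟨Finset.mem_powerset_self F, hh⟩, hvM, hva, ?_⟩
    rw [hsymm, map_sum, hC]
    calc |∑ x ∈ F, B v x| ≤ ∑ x ∈ F, |B v x| := Finset.abs_sum_le_sum_abs _ _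
      _ ≤ F.card • K := Finset.sum_le_card_nsmul _ _ _ hb
      _ = F.card * K := by simp
  · have hsupp : ∑ x ∈ F, c x • x = ∑ x ∈ F with B v x = 0, c x • x := by
      by_cases h1 : ∃ p ∈ F, 0 < B v p
      · have h2 : ∀ x ∈ F, 0 ≤ B v x := by
          intro x hx
          by_contra hcon
          exact hcase ⟨h1, x, hx, not_le.1 hcon⟩
        exact aux_support B F c hc v hvz h2
      · have h2 : ∀ x ∈ F, 0 ≤ B (-v) x := by
          intro x hx
          by_contra hcon
          apply h1
          refine ⟨x, hx, ?_⟩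
          simp at hcon
          exact hcon
        have h3 := aux_support B F c hc (-v) (by rw [map_neg, LinearMap.neg_apply, hvz, neg_zero]) h2
        simpa using h3
    have hz' := hz
    rw [hsupp] at hz'
    have hh := aux_sumpos B _ (fun x hx y hy =>
      hFdot x (Finset.mem_filter.1 hx).1 y (Finset.mem_filter.1 hy).1) c hz'
    refine ⟨F.filter (fun x => B v x = 0), Finset.mem_filter.2
      ⟨Finset.mem_powerset.2 (Finset.filter_subset _ _), hh⟩, hvM, hva, ?_⟩
    rw [hsymm, map_sum, Finset.sum_eq_zero (fun x hx => (Finset.mem_filter.1 hx).2), abs_zero]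
    exact hC0
end

section
/- Let k be a totally real number field and F a number field containing k with [F : k] = 2. Let r be the number of real embeddings of F (i.e., of field homomorphisms F → ℝ); then r is even. The norm map N_{F/k} : O_F^× → O_k^× between the unit groups of the rings of integers has finite cokernel (its image has finite index in O_k^×), and its kernel {u ∈ O_F^× : N_{F/k}(u) = 1} is a finitely generated abelian group of rank exactly r/2. In particular, if F has at least two real embeddings, this kernel is infinite. -/
open scoped TensorProduct

open NumberField

theorem aux_linear {A B : Type*} [AddCommGroup A] [AddCommGroup B] [Module.Finite ℤ A]
    [Module.Finite ℤ B] (f : A →ₗ[ℤ] B) (h : ∀ b : B, (2 : ℤ) • b ∈ LinearMap.range f) :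
    Finite (B ⧸ LinearMap.range f) ∧
    Module.finrank ℤ (LinearMap.ker f) + Module.finrank ℤ B = Module.finrank ℤ A := by
  have ht : Module.IsTorsion ℤ (B ⧸ LinearMap.range f) := by
    intro x
    obtain ⟨b, rfl⟩ := Submodule.Quotient.mk_surjective _ x
    refine ⟨⟨2, by simp⟩, ?_⟩
    change (2 : ℤ) • (Submodule.Quotient.mk b : B ⧸ LinearMap.range f) = 0
    rw [← Submodule.Quotient.mk_smul, Submodule.Quotient.mk_eq_zero]
    exact h b
  refine ⟨Module.finite_of_fg_torsion _ ht, ?_⟩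
  have h0 := Module.finrank_eq_zero_iff_isTorsion.mpr ht
  have h1 := Submodule.finrank_quotient_add_finrank (LinearMap.range f)
  have h2 := Submodule.finrank_quotient_add_finrank (LinearMap.ker f)
  have h3 := f.quotKerEquivRange.finrank_eq
  omega

theorem aux_group {G H : Type*} [CommGroup G] [CommGroup H] [Module.Finite ℤ (Additive G)]
    [Module.Finite ℤ (Additive H)] (f : G →* H) (h : ∀ b : H, b ^ 2 ∈ f.range) :
    f.range.FiniteIndex ∧ Group.FG f.ker ∧
    Module.finrank ℤ (Additive f.ker) + Module.finrank ℤ (Additive H) =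
      Module.finrank ℤ (Additive G) := by
  let g : Additive G →ₗ[ℤ] Additive H := (MonoidHom.toAdditive f).toIntLinearMap
  obtain ⟨h1, h2⟩ := aux_linear g (by
    intro b
    obtain ⟨a, ha⟩ := h b.toMul
    refine ⟨Additive.ofMul a, ?_⟩
    change Additive.ofMul (f a) = _
    rw [ha, ofMul_pow, ofMul_toMul]
    simp [two_smul])
  let e : Additive f.ker ≃+ LinearMap.ker g :=
    { toFun := fun x => ⟨Additive.ofMul (x.toMul : G), x.toMul.2⟩
      invFun := fun x => Additive.ofMul ⟨x.1.toMul, x.2⟩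
      left_inv := fun x => rfl
      right_inv := fun x => rfl
      map_add' := fun x y => rfl }
  refine ⟨?_, ?_, ?_⟩
  · have : Finite (H ⧸ f.range) := by
      refine Finite.of_surjective
        (fun q : Additive H ⧸ LinearMap.range g =>
          Quotient.liftOn' q (fun b => (QuotientGroup.mk b.toMul : H ⧸ f.range)) ?_) ?_
      · intro a b hab
        rw [Submodule.quotientRel_def] at hab
        obtain ⟨c, hc⟩ := hab
        refine (QuotientGroup.eq.mpr ?_).symm
        refine ⟨c.toMul, ?_⟩
        change Additive.ofMul (f c.toMul) = a - b at hc
        have := congrArg Additive.toMul hc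
        simp only [toMul_ofMul, toMul_sub] at this
        rw [this, div_eq_mul_inv, mul_comm]
      · intro q
        obtain ⟨b, rfl⟩ := QuotientGroup.mk_surjective q
        exact ⟨Submodule.Quotient.mk (Additive.ofMul b), rfl⟩
    exact Subgroup.finiteIndex_of_finite_quotient
  · have : Module.Finite ℤ (Additive f.ker) := Module.Finite.equiv e.toIntLinearEquiv.symm
    rw [GroupFG.iff_add_fg, ← Module.Finite.iff_addGroup_fg]
    exact this
  · rw [e.toIntLinearEquiv.finrank_eq]; exact h2

theorem aux_card (F : Type*) [Field F] [NumberField F] :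
    Nat.card (F →+* ℝ) = InfinitePlace.nrRealPlaces F := by
  classical
  rw [← InfinitePlace.card_real_embeddings, ← Nat.card_eq_fintype_card]
  refine Nat.card_congr
    { toFun := fun φ => ⟨Complex.ofRealHom.comp φ, ?_⟩
      invFun := fun φ => φ.2.embedding
      left_inv := ?_
      right_inv := ?_ }
  · ext x; simp
  · intro φ; ext x
    apply Complex.ofReal_injective
    rw [ComplexEmbedding.IsReal.coe_embedding_apply]; rfl
  · intro φ; ext x
    exact ComplexEmbedding.IsReal.coe_embedding_apply φ.2 x

/-- Let `k` be a totally real number field and `F ⊇ k` with `[F : k] = 2`.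
Then the number `r` of real embeddings of `F` is even; the norm map between the unit
groups of the rings of integers has finite cokernel; and its kernel (the group of units
of norm `1`) is a finitely generated abelian group of rank exactly `r/2`.  In particular
if `r ≥ 2` this kernel is infinite. -/
theorem stmt_11
    (k F : Type*) [Field k] [NumberField k] [Field F] [NumberField F] [Algebra k F]
    (htotreal : ∀ (φ : k →+* ℂ) (x : k), (φ x).im = 0)
    (hdeg : Module.finrank k F = 2) :
    Even (Nat.card (F →+* ℝ)) ∧
    -- the image of the norm map `O_F^× → O_k^×` has finite index
    (∃ Img : Subgroup (𝓞 k)ˣ,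
      (∀ x : (𝓞 k)ˣ, x ∈ Img ↔ ∃ u : (𝓞 F)ˣ,
        algebraMap (𝓞 k) k (x : 𝓞 k) =
          Algebra.norm k (algebraMap (𝓞 F) F (u : 𝓞 F))) ∧
      Img.FiniteIndex) ∧
    -- the kernel of the norm map is finitely generated of rank `r/2`
    (∃ Ker : Subgroup (𝓞 F)ˣ,
      (∀ u : (𝓞 F)ˣ, u ∈ Ker ↔
        Algebra.norm k (algebraMap (𝓞 F) F (u : 𝓞 F)) = 1) ∧
      Group.FG Ker ∧
      Module.finrank ℚ (ℚ ⊗[ℤ] Additive Ker) = Nat.card (F →+* ℝ) / 2 ∧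
      (2 ≤ Nat.card (F →+* ℝ) → Infinite Ker)) := by
  have hreal : IsTotallyReal k := ⟨fun v => by
    rw [InfinitePlace.isReal_iff]
    ext x
    exact Complex.conj_eq_iff_im.mpr (htotreal v.embedding x)⟩
  have hk1 := IsTotallyReal.finrank k
  have hk0 := IsTotallyReal.nrComplexPlaces_eq_zero k
  have hk2 := InfinitePlace.card_eq_nrRealPlaces_add_nrComplexPlaces k
  have hF1 := InfinitePlace.card_add_two_mul_card_eq_rank F
  have hF2 := InfinitePlace.card_eq_nrRealPlaces_add_nrComplexPlaces F
  have htow := Module.finrank_mul_finrank ℚ k F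
  have hkpos : 0 < Module.finrank ℚ k := Module.finrank_pos
  have hrk := Units.finrank_eq k
  have hrF := Units.finrank_eq F
  unfold Units.rank at hrk hrF
  rw [hdeg] at htow
  rw [aux_card F]
  let N : (𝓞 F)ˣ →* (𝓞 k)ˣ := Units.map (RingOfIntegers.norm k)
  have hN : ∀ u : (𝓞 F)ˣ, algebraMap (𝓞 k) k ((N u : (𝓞 k)ˣ) : 𝓞 k) =
      Algebra.norm k (algebraMap (𝓞 F) F (u : 𝓞 F)) := fun u => rfl
  obtain ⟨h1, h2, h3⟩ := aux_group N (by
    intro b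
    refine ⟨Units.map (algebraMap (𝓞 k) (𝓞 F)).toMonoidHom b, ?_⟩
    ext1
    have := RingOfIntegers.norm_algebraMap (L := F) k (b : 𝓞 k)
    rw [hdeg] at this
    rw [Units.val_pow_eq_pow_val, ← this]
    rfl)
  have hrank : Module.finrank ℤ (Additive N.ker) = InfinitePlace.nrRealPlaces F / 2 := by omega
  refine ⟨by rw [Nat.even_iff]; omega, ⟨N.range, fun x => ?_, h1⟩, N.ker, fun u => ?_, h2, ?_, ?_⟩
  · constructor
    · rintro ⟨u, rfl⟩; exact ⟨u, hN u⟩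
    · rintro ⟨u, hu⟩
      refine ⟨u, ?_⟩
      ext
      exact (hN u).trans hu.symm
  · rw [MonoidHom.mem_ker, ← hN, Units.ext_iff, ← map_one (algebraMap (𝓞 k) k),
      (RingOfIntegers.coe_injective (K := k)).eq_iff, Units.val_one]
  · rw [← hrank]
    exact (TensorProduct.isBaseChange ℤ (Additive N.ker) ℚ).finrank_eq
  · intro hr
    by_contra hfin
    rw [not_infinite_iff_finite] at hfin
    have : Module.Finite ℤ (Additive N.ker) := by
      rw [Module.Finite.iff_addGroup_fg, ← GroupFG.iff_add_fg]; exact h2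
    have h0 : Module.finrank ℤ (Additive N.ker) = 0 := by
      rw [Module.finrank_eq_zero_iff_isTorsion]
      intro x
      refine ⟨⟨(Nat.card N.ker : ℤ), mem_nonZeroDivisors_of_ne_zero
        (Nat.cast_ne_zero.mpr Nat.card_pos.ne')⟩, ?_⟩
      change (Nat.card N.ker : ℤ) • x = 0
      rw [natCast_zsmul]
      exact card_nsmul_eq_zero' (G := Additive N.ker)
    omega
end
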